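/- arXiv:math/0109206 — 2 statements merged into one kernel-verified Lean document; each statement's English description precedes it below -/
import Mathlib

section
/- (Complementation lemma) Let 0 < p < 1. There exist a constant C > 0 and a linear map Q taking pairs (f, g), where f : ℂ_+ → ℂ and g : ℂ_- → ℂ, to functions ℂ → ℂ, such that: (i) whenever f ∈ H^p(ℂ_+) and g ∈ H^p(ℂ_-), the function Q(f,g) belongs to E^p and ‖Q(f,g)‖_{E^p}^p ≤ C (‖f‖_{H^p(ℂ_+)}^p + ‖g‖_{H^p(ℂ_-)}^p); and (ii) for every h ∈ E^p, Q(h_π|_{ℂ_+}, h_{-π}|_{ℂ_-}) = h, where h_{±π}(z) = e^{±iπz} h(z). Consequently the image of E^p under h ↦ (h_π|_{ℂ_+}, h_{-π}|_{ℂ_-}) is a complemented subspace of H^p(ℂ_+) ⊕ H^p(ℂ_-). -/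
open MeasureTheory Real Complex
open scoped ENNReal NNReal

/-- An entire function of exponential type `π`. -/
def ExpTypePi (f : ℂ → ℂ) : Prop :=
  Differentiable ℂ f ∧
    ∀ ε > 0, ∃ C > 0, ∀ z : ℂ, ‖f z‖ ≤ C * Real.exp ((Real.pi + ε) * ‖z‖)

namespace CompLemma

/-- Sub-mean value property on circles for `‖f‖ ^ p`. -/
lemma circle_submean {p : ℝ} (hp : 0 < p) {f : ℂ → ℂ} {c : ℂ} {R : ℝ} (hR : 0 < R)
    (hf : AnalyticOnNhd ℂ f (Metric.closedBall c R)) :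
    ‖f c‖ ^ p ≤ Real.circleAverage (fun z => ‖f z‖ ^ p) c R := by
  have habs : |R| = R := abs_of_pos hR
  have hcont : ∀ g : ℂ → ℂ, AnalyticOnNhd ℂ g (Metric.closedBall c R) →
      CircleIntegrable (fun z => ‖g z‖ ^ p) c R := by
    intro g hg
    apply ContinuousOn.circleIntegrable hR.le
    have := (hg.continuousOn.mono Metric.sphere_subset_closedBall).norm
    exact this.rpow_const (fun _ _ => Or.inr hp.le)
  by_cases h0 : f c = 0
  · rw [h0, norm_zero, Real.zero_rpow hp.ne']
    unfold Real.circleAverage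
    have : 0 ≤ ∫ θ in (0:ℝ)..2 * π, (fun z => ‖f z‖ ^ p) (circleMap c R θ) := by
      apply intervalIntegral.integral_nonneg (by positivity)
      intro u _
      positivity
    simp only [smul_eq_mul]
    positivity
  · -- rescale so that `‖G c‖ = exp (1/p)`
    set L : ℝ := Real.exp (1 / p) / ‖f c‖ with hL
    have hfc : 0 < ‖f c‖ := norm_pos_iff.mpr h0
    have hLpos : 0 < L := by positivity
    set G : ℂ → ℂ := fun z => (L : ℂ) * f z with hG
    have hGan : AnalyticOnNhd ℂ G (Metric.closedBall c R) := fun z hz =>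
      analyticAt_const.mul (hf z hz)
    have hGnorm : ∀ z, ‖G z‖ = L * ‖f z‖ := by
      intro z; simp [hG, abs_of_pos hLpos]
    have hGc : ‖G c‖ = Real.exp (1 / p) := by
      rw [hGnorm, hL]; field_simp
    have hGc0 : G c ≠ 0 := by
      rw [← norm_pos_iff, hGc]; positivity
    have hJ := AnalyticOnNhd.circleAverage_log_norm (f := G) (c := c) (R := R) hR.ne'
      (by rwa [habs]) hGc0
    have hpos : 0 ≤ ∑ᶠ u, (MeromorphicOn.divisor G (Metric.closedBall c |R|) u : ℝ)
        * Real.log (R * ‖c - u‖⁻¹) := by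
      apply finsum_nonneg
      intro u
      by_cases hu : u ∈ Metric.closedBall c |R|
      · apply mul_nonneg
        · have := MeromorphicOn.AnalyticOnNhd.divisor_nonneg (f := G) (U := Metric.closedBall c |R|)
            (by rwa [habs])
          exact_mod_cast this u
        · rw [habs] at hu
          rcases eq_or_ne (‖c - u‖) 0 with h | h
          · simp [h]
          · apply Real.log_nonneg
            have h1 : 0 < ‖c - u‖ := lt_of_le_of_ne (norm_nonneg _) (Ne.symm h)
            rw [← div_eq_mul_inv, le_div_iff₀ h1, one_mul, ← dist_eq_norm, dist_comm]
            exact hu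
      · simp [hu]
    have hlog : 1 / p ≤ Real.circleAverage (Real.log ‖G ·‖) c R := by
      rw [hJ, hGc, Real.log_exp]; linarith
    have hpt : ∀ z, Real.exp 1 * p * Real.log ‖G z‖ ≤ ‖G z‖ ^ p := by
      intro z
      rcases eq_or_lt_of_le (norm_nonneg (G z)) with h | h
      · rw [← h]; simp [Real.zero_rpow hp.ne']
      · rw [Real.rpow_def_of_pos h]
        have := Real.add_one_le_exp (Real.log ‖G z‖ * p - 1)
        have h2 : Real.exp (Real.log ‖G z‖ * p) = Real.exp 1 * Real.exp (Real.log ‖G z‖ * p - 1) := by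
          rw [← Real.exp_add]; ring_nf
        rw [h2]
        have := mul_le_mul_of_nonneg_left this (Real.exp_pos 1).le
        nlinarith
    have hintg : CircleIntegrable (fun z => Real.log ‖G z‖) c R := by
      apply MeromorphicOn.circleIntegrable_log_norm
      rw [habs]
      exact (hGan.mono Metric.sphere_subset_closedBall).meromorphicOn
    have hintg2 : CircleIntegrable (fun z => Real.exp 1 * p * Real.log ‖G z‖) c R := by
      exact hintg.const_mul _
    have hmono := Real.circleAverage_mono hintg2 (hcont G hGan) (fun z _ => hpt z)
    have e1 : Real.circleAverage (fun z => Real.exp 1 * p * Real.log ‖G z‖) c R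
        = Real.exp 1 * p * Real.circleAverage (fun z => Real.log ‖G z‖) c R := by
      unfold Real.circleAverage
      simp only [smul_eq_mul]
      rw [intervalIntegral.integral_const_mul]
      ring
    have e2 : Real.circleAverage (fun z => ‖G z‖ ^ p) c R
        = L ^ p * Real.circleAverage (fun z => ‖f z‖ ^ p) c R := by
      unfold Real.circleAverage
      simp only [smul_eq_mul, hGnorm]
      simp_rw [Real.mul_rpow hLpos.le (norm_nonneg _)]
      rw [intervalIntegral.integral_const_mul]
      ring
    rw [e1, e2] at hmono
    have e3 : Real.exp 1 ≤ L ^ p * Real.circleAverage (fun z => ‖f z‖ ^ p) c R := by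
      refine le_trans ?_ hmono
      have := mul_le_mul_of_nonneg_left hlog (show 0 ≤ Real.exp 1 * p by positivity)
      have h3 : Real.exp 1 * p * (1 / p) = Real.exp 1 := by field_simp
      rw [h3] at this
      exact this
    have e4 : L ^ p * ‖f c‖ ^ p = Real.exp 1 := by
      rw [← Real.mul_rpow hLpos.le (norm_nonneg _), ← hGnorm, hGc, ← Real.exp_mul]
      congr 1; field_simp
    rw [← e4] at e3
    exact le_of_mul_le_mul_left e3 (by positivity)

/-- The same in `lintegral` form. -/
lemma circle_submean_lintegral {p : ℝ} (hp : 0 < p) {f : ℂ → ℂ} {c : ℂ} {R : ℝ} (hR : 0 < R)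
    (hf : AnalyticOnNhd ℂ f (Metric.closedBall c R)) :
    ENNReal.ofReal (2 * π) * ‖f c‖ₑ ^ p ≤
      ∫⁻ θ in Set.Ioo (-π) π,
        ‖f (c + (R : ℂ) * (Real.cos θ + Real.sin θ * Complex.I))‖ₑ ^ p := by
  have h := circle_submean hp hR hf
  have hm : ∀ θ : ℝ, circleMap c R θ = c + (R : ℂ) * (Real.cos θ + Real.sin θ * Complex.I) := by
    intro θ
    simp [circleMap, Complex.exp_mul_I]
  have hcm : ContinuousOn (fun θ : ℝ => ‖f (circleMap c R θ)‖ ^ p) Set.univ := by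
    refine ContinuousOn.rpow_const ?_ (fun _ _ => Or.inr hp.le)
    refine ContinuousOn.norm ?_
    refine hf.continuousOn.comp (continuous_circleMap c R).continuousOn ?_
    intro θ _
    exact Metric.sphere_subset_closedBall (circleMap_mem_sphere c hR.le θ)
  have hcm' : Continuous (fun θ : ℝ => ‖f (circleMap c R θ)‖ ^ p) := continuousOn_univ.mp hcm
  have h2 : 2 * π * ‖f c‖ ^ p ≤ ∫ θ in (-π)..π, ‖f (circleMap c R θ)‖ ^ p := by
    rw [Real.circleAverage_eq_integral_add (-π)] at h
    rw [intervalIntegral.integral_comp_add_right (fun θ => ‖f (circleMap c R θ)‖ ^ p) (-π)] at h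
    have e : 2 * π + -π = π := by ring
    rw [zero_add, e, smul_eq_mul] at h
    have hpi : 0 < 2 * π := by positivity
    rwa [inv_mul_eq_div, le_div_iff₀ hpi, mul_comm] at h
  rw [intervalIntegral.integral_of_le (by linarith [Real.pi_pos]),
    MeasureTheory.integral_Ioc_eq_integral_Ioo] at h2
  have h3 := ENNReal.ofReal_le_ofReal h2
  rw [ofReal_integral_eq_lintegral_ofReal] at h3
  · rw [ENNReal.ofReal_mul (by positivity), ← ENNReal.ofReal_rpow_of_nonneg (norm_nonneg _) hp.le,
      ofReal_norm] at h3
    refine h3.trans (le_of_eq ?_)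
    refine lintegral_congr fun θ => ?_
    rw [← ENNReal.ofReal_rpow_of_nonneg (norm_nonneg _) hp.le, ofReal_norm, hm]
  · exact (hcm'.integrableOn_Icc (a := -π) (b := π)).mono_set Set.Ioo_subset_Icc_self
  · exact Filter.Eventually.of_forall fun θ => by positivity

lemma measurable_indicator_of_diff {U : Set ℂ} (hU : IsOpen U) {f : ℂ → ℂ}
    (hf : DifferentiableOn ℂ f U) (p : ℝ) :
    Measurable (U.indicator (fun z => ‖f z‖ₑ ^ p)) := by
  have h1 : Measurable (U.indicator f) := by
    classical
    rw [← Set.piecewise_eq_indicator]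
    exact ContinuousOn.measurable_piecewise hf.continuousOn continuousOn_const hU.measurableSet
  have : U.indicator (fun z => ‖f z‖ₑ ^ p) = U.indicator (fun z => ‖U.indicator f z‖ₑ ^ p) := by
    ext z
    by_cases hz : z ∈ U <;> simp [hz]
  rw [this]
  exact (h1.enorm.pow_const p).indicator hU.measurableSet

/-- Sub-mean value property on discs. -/
lemma disc_submean {p : ℝ} (hp : 0 < p) {f : ℂ → ℂ} {c : ℂ} {r : ℝ} {U : Set ℂ} (hr : 0 < r)
    (hU : IsOpen U) (hf : DifferentiableOn ℂ f U) (hb : Metric.ball c r ⊆ U) :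
    ENNReal.ofReal (π * r ^ 2) * ‖f c‖ₑ ^ p ≤ ∫⁻ z in Metric.ball c r, ‖f z‖ₑ ^ p := by
  set g : ℂ → ℝ≥0∞ := U.indicator (fun z => ‖f z‖ₑ ^ p) with hg
  have hgm : Measurable g := measurable_indicator_of_diff hU hf p
  have e1 : ∫⁻ z in Metric.ball c r, ‖f z‖ₑ ^ p = ∫⁻ z in Metric.ball c r, g z := by
    refine setLIntegral_congr_fun measurableSet_ball fun z hz => ?_
    simp [hg, hb hz]
  have e2 : ∫⁻ z in Metric.ball c r, g z
      = ∫⁻ z, (Metric.ball (0:ℂ) r).indicator (fun z => g (c + z)) z := by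
    rw [← lintegral_indicator measurableSet_ball,
      ← lintegral_add_left_eq_self _ c]
    refine lintegral_congr fun z => ?_
    by_cases hz : z ∈ Metric.ball (0:ℂ) r
    · have : c + z ∈ Metric.ball c r := by simpa using hz
      rw [Set.indicator_of_mem hz, Set.indicator_of_mem this]
    · have : c + z ∉ Metric.ball c r := by simpa using hz
      rw [Set.indicator_of_notMem hz, Set.indicator_of_notMem this]
  rw [e1, e2, ← Complex.lintegral_comp_polarCoord_symm]
  set F : ℝ × ℝ → ℝ≥0∞ := fun q => ENNReal.ofReal q.1 *
    g (c + (q.1 : ℂ) * (Real.cos q.2 + Real.sin q.2 * Complex.I)) with hF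
  have hFm : Measurable F := by
    refine Measurable.mul (by fun_prop) (hgm.comp ?_)
    fun_prop
  have e3 : ∫⁻ q in Set.Ioo 0 r ×ˢ Set.Ioo (-π) π, F q ≤
      ∫⁻ q in polarCoord.target, ENNReal.ofReal q.1 •
        (Metric.ball (0:ℂ) r).indicator (fun z => g (c + z)) (Complex.polarCoord.symm q) := by
    have hsub : Set.Ioo 0 r ×ˢ Set.Ioo (-π) π ⊆ polarCoord.target := by
      rintro ⟨a, b⟩ ⟨ha, hb⟩
      exact ⟨ha.1, hb⟩
    refine le_trans (le_of_eq ?_) (lintegral_mono_set hsub)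
    refine setLIntegral_congr_fun (measurableSet_Ioo.prod measurableSet_Ioo) fun q hq => ?_
    have hmem : Complex.polarCoord.symm q ∈ Metric.ball (0:ℂ) r := by
      rw [mem_ball_zero_iff, Complex.norm_polarCoord_symm, abs_of_pos hq.1.1]
      exact hq.1.2
    simp only [Set.indicator_of_mem hmem, smul_eq_mul, hF]
    rw [Complex.polarCoord_symm_apply]
  refine le_trans ?_ e3
  rw [Measure.volume_eq_prod, ← Measure.prod_restrict, lintegral_prod _ hFm.aemeasurable]
  have e4 : ∀ ρ ∈ Set.Ioo 0 r, ENNReal.ofReal (2 * π) * ‖f c‖ₑ ^ p * ENNReal.ofReal ρ ≤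
      ∫⁻ θ in Set.Ioo (-π) π, F (ρ, θ) := by
    intro ρ hρ
    have hball : Metric.closedBall c ρ ⊆ U :=
      (Metric.closedBall_subset_ball hρ.2).trans hb
    have := circle_submean_lintegral (f := f) (c := c) hp hρ.1
      ((hf.analyticOnNhd hU).mono hball)
    simp only [hF]
    rw [lintegral_const_mul _ (by fun_prop), mul_comm]
    gcongr
    refine this.trans (le_of_eq ?_)
    refine lintegral_congr fun θ => ?_
    have hmem : c + (ρ : ℂ) * (Real.cos θ + Real.sin θ * Complex.I) ∈ U := by
      apply hball
      have := circleMap_mem_closedBall c hρ.1.le θ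
      simpa [circleMap, Complex.exp_mul_I] using this
    simp only [hg, Set.indicator_of_mem hmem]
  refine le_trans ?_ (setLIntegral_mono' measurableSet_Ioo e4)
  rw [lintegral_const_mul _ (by fun_prop)]
  have e5 : ∫⁻ ρ in Set.Ioo 0 r, ENNReal.ofReal ρ = ENNReal.ofReal (r ^ 2 / 2) := by
    rw [← ofReal_integral_eq_lintegral_ofReal]
    · rw [← MeasureTheory.integral_Ioc_eq_integral_Ioo, ← intervalIntegral.integral_of_le hr.le,
        integral_id]
      simp
    · exact (continuous_id.integrableOn_Icc (a := (0:ℝ)) (b := r)).mono_set Set.Ioo_subset_Icc_self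
    · exact (ae_restrict_mem measurableSet_Ioo).mono fun x hx => hx.1.le
  rw [e5, mul_right_comm, ← ENNReal.ofReal_mul (by positivity),
    show 2 * π * (r ^ 2 / 2) = π * r ^ 2 by ring]

/-- Fubini on strips. -/
lemma strip_lintegral {g : ℂ → ℝ≥0∞} (hg : Measurable g) {a b : ℝ} {S : ℝ≥0∞}
    (h : ∀ y : ℝ, a < y → y < b → y ≠ 0 → ∫⁻ x : ℝ, g (x + y * Complex.I) ≤ S) :
    ∫⁻ z in {z : ℂ | a < z.im ∧ z.im < b}, g z ≤ ENNReal.ofReal (b - a) * S := by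
  have hms : MeasurableSet {z : ℂ | a < z.im ∧ z.im < b} :=
    ((isOpen_lt continuous_const Complex.continuous_im).inter
      (isOpen_lt Complex.continuous_im continuous_const)).measurableSet
  rw [← lintegral_indicator hms,
    ← (Complex.volume_preserving_equiv_real_prod.symm).lintegral_comp_emb
      measurableEquivRealProd.symm.measurableEmbedding, Measure.volume_eq_prod,
      lintegral_prod_symm]
  · have e : ∀ y x : ℝ, {z : ℂ | a < z.im ∧ z.im < b}.indicator g
        (measurableEquivRealProd.symm (x, y)) =
        (Set.Ioo a b).indicator (fun y : ℝ => g (x + y * Complex.I)) y := by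
      intro y x
      have e0 : measurableEquivRealProd.symm (x, y) = (x : ℂ) + y * Complex.I := by
        apply Complex.ext <;> simp [measurableEquivRealProd]
      rw [e0]
      simp only [Set.indicator, Set.mem_ofPred_eq, Set.mem_Ioo]
      simp
    simp_rw [e]
    have e2 : ∀ᵐ y : ℝ, ∫⁻ x : ℝ, (Set.Ioo a b).indicator (fun y : ℝ => g (x + y * Complex.I)) y
        ≤ (Set.Ioo a b).indicator (fun _ => S) y := by
      have : ∀ᵐ y : ℝ, y ≠ 0 := by
        simp [ae_iff]
      filter_upwards [this] with y hy
      by_cases hm : y ∈ Set.Ioo a b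
      · simpa [hm] using h y hm.1 hm.2 hy
      · simp [hm]
    refine (lintegral_mono_ae e2).trans ?_
    rw [lintegral_indicator measurableSet_Ioo, setLIntegral_const, Real.volume_Ioo, mul_comm]
  · exact ((hg.indicator hms).comp measurableEquivRealProd.symm.measurable).aemeasurable

end CompLemma

namespace CompLemma

open Filter Topology in
/-- Shifting a horizontal line of integration. -/
lemma shift_line {G : ℂ → ℂ} {c₁ c₂ x₀ B : ℝ} (h12 : c₁ ≤ c₂)
    (hG : DifferentiableOn ℂ G {w : ℂ | c₁ ≤ w.im ∧ w.im ≤ c₂})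
    (h1 : Integrable fun t : ℝ => G (t + c₁ * Complex.I))
    (h2 : Integrable fun t : ℝ => G (t + c₂ * Complex.I))
    (hb : ∀ t s : ℝ, 1 ≤ |t - x₀| → c₁ ≤ s → s ≤ c₂ → ‖G (t + s * Complex.I)‖ ≤ B / |t - x₀|) :
    ∫ t : ℝ, G (t + c₁ * Complex.I) = ∫ t : ℝ, G (t + c₂ * Complex.I) := by
  have hrect : ∀ R : ℝ,
      (∫ t in (x₀ - R)..(x₀ + R), G (t + c₁ * Complex.I))
        - (∫ t in (x₀ - R)..(x₀ + R), G (t + c₂ * Complex.I))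
      = Complex.I * (∫ y in c₁..c₂, G ((x₀ - R : ℝ) + y * Complex.I))
        - Complex.I * (∫ y in c₁..c₂, G ((x₀ + R : ℝ) + y * Complex.I)) := by
    intro R
    have := Complex.integral_boundary_rect_eq_zero_of_differentiableOn G
      ⟨x₀ - R, c₁⟩ ⟨x₀ + R, c₂⟩ (hG.mono (by
        rintro w ⟨_, hw⟩
        simp only [Set.mem_preimage, Set.uIcc_of_le h12] at hw
        exact ⟨hw.1, hw.2⟩))
    simp only [smul_eq_mul] at this
    linear_combination this
  have hside : ∀ (σ : ℝ), |σ| = 1 → Tendsto (fun R : ℝ =>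
      Complex.I * (∫ y in c₁..c₂, G ((x₀ + σ * R : ℝ) + y * Complex.I))) atTop (𝓝 0) := by
    intro σ hσ
    have hz : Tendsto (fun R : ℝ => B / R * |c₂ - c₁|) atTop (𝓝 0) := by
      have : Tendsto (fun R : ℝ => B / R) atTop (𝓝 0) := tendsto_const_nhds.div_atTop tendsto_id
      simpa using this.mul_const (|c₂ - c₁|)
    refine squeeze_zero_norm' ?_ hz
    filter_upwards [eventually_ge_atTop (1:ℝ)] with R hR
    rw [norm_mul, Complex.norm_I, one_mul]
    have hR' : |x₀ + σ * R - x₀| = R := by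
      rw [add_sub_cancel_left, abs_mul, hσ, one_mul, abs_of_pos (by linarith)]
    apply intervalIntegral.norm_integral_le_of_norm_le_const
    intro y hy
    rw [Set.uIoc_of_le h12] at hy
    have := hb (x₀ + σ * R) y (by rw [hR']; exact hR) hy.1.le hy.2
    rwa [hR'] at this
  have ha : Tendsto (fun R : ℝ => x₀ - R) atTop atBot :=
    tendsto_atBot_add_const_left _ x₀ tendsto_neg_atTop_atBot |>.congr fun R => by ring
  have hb' : Tendsto (fun R : ℝ => x₀ + R) atTop atTop :=
    tendsto_atTop_add_const_left _ x₀ tendsto_id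
  have l1 := intervalIntegral_tendsto_integral h1 ha hb'
  have l2 := intervalIntegral_tendsto_integral h2 ha hb'
  have l3 := l1.sub l2
  have s1 := hside (-1) (by simp)
  have s2 := hside 1 (by simp)
  have l4 := s1.sub s2
  have := tendsto_nhds_unique (l3.congr fun R => by
    rw [hrect R]) (l4.congr fun R => by
      rw [show x₀ + -1 * R = x₀ - R by ring, one_mul])
  rw [sub_zero] at this
  exact sub_eq_zero.mp this

/-- Entire bump of exponential type `π`, a power of `sinc`. -/
noncomputable def Phi (N : ℕ) (z : ℂ) : ℂ := (dslope Complex.sin 0 (((π / N : ℝ) : ℂ) * z)) ^ N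

/-- The kernel. -/
noncomputable def ker (N : ℕ) (z : ℂ) : ℂ := Phi N z / z

lemma Phi_differentiable (N : ℕ) : Differentiable ℂ (Phi N) := by
  have h : Differentiable ℂ (dslope Complex.sin 0) := by
    rw [← differentiableOn_univ, Complex.differentiableOn_dslope Filter.univ_mem]
    exact Complex.differentiable_sin.differentiableOn
  unfold Phi
  exact (h.comp (differentiable_id.const_mul _)).pow N

lemma Phi_zero (N : ℕ) : Phi N 0 = 1 := by
  simp [Phi]

lemma Phi_of_ne {N : ℕ} (hN : 1 ≤ N) {z : ℂ} (hz : z ≠ 0) :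
    Phi N z = (Complex.sin (((π / N : ℝ) : ℂ) * z) / (((π / N : ℝ) : ℂ) * z)) ^ N := by
  have h : ((π / N : ℝ) : ℂ) * z ≠ 0 := by
    refine mul_ne_zero ?_ hz
    have : (0:ℝ) < π / N := div_pos Real.pi_pos (by exact_mod_cast hN)
    exact_mod_cast this.ne'
  unfold Phi
  rw [dslope_of_ne _ h, slope_def_field]
  simp

lemma ker_neg {N : ℕ} (hN : 1 ≤ N) (z : ℂ) : ker N (-z) = - ker N z := by
  rcases eq_or_ne z 0 with rfl | hz
  · simp [ker]
  · unfold ker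
    rw [Phi_of_ne hN hz, Phi_of_ne hN (neg_ne_zero.mpr hz), mul_neg, Complex.sin_neg, neg_div_neg_eq,
      div_neg]

lemma ker_differentiableAt (N : ℕ) {z : ℂ} (hz : z ≠ 0) : DifferentiableAt ℂ (ker N) z :=
  (Phi_differentiable N z).div differentiableAt_id hz

lemma norm_sin_le (z : ℂ) : ‖Complex.sin z‖ ≤ Real.exp |z.im| := by
  have h1 : ‖Complex.exp (-z * Complex.I)‖ ≤ Real.exp |z.im| := by
    rw [Complex.norm_exp]
    apply Real.exp_le_exp.mpr
    simpa using le_abs_self z.im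
  have h2 : ‖Complex.exp (z * Complex.I)‖ ≤ Real.exp |z.im| := by
    rw [Complex.norm_exp]
    apply Real.exp_le_exp.mpr
    simpa using neg_le_abs z.im
  unfold Complex.sin
  rw [norm_div, norm_mul, Complex.norm_I, mul_one]
  have := norm_sub_le (Complex.exp (-z * Complex.I)) (Complex.exp (z * Complex.I))
  simp only [Complex.norm_ofNat]
  linarith

lemma ker_bound {N : ℕ} (hN : 1 ≤ N) {z : ℂ} (hz : z ≠ 0) :
    ‖ker N z‖ ≤ (N / π) ^ N * Real.exp (π * |z.im|) / ‖z‖ ^ (N + 1) := by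
  have hN0 : (0:ℝ) < N := by exact_mod_cast hN
  have ha : (0:ℝ) < π / N := div_pos Real.pi_pos hN0
  have hz' : 0 < ‖z‖ := norm_pos_iff.mpr hz
  have h1 : ‖Complex.sin (((π / N : ℝ) : ℂ) * z) / (((π / N : ℝ) : ℂ) * z)‖ ≤
      Real.exp (π / N * |z.im|) / (π / N * ‖z‖) := by
    rw [norm_div, norm_mul, Complex.norm_real, Real.norm_of_nonneg ha.le]
    gcongr
    refine (norm_sin_le _).trans (le_of_eq ?_)
    simp [abs_mul, abs_of_pos ha]
  unfold ker
  rw [Phi_of_ne hN hz, norm_div, norm_pow]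
  calc _ ≤ (Real.exp (π / N * |z.im|) / (π / N * ‖z‖)) ^ N / ‖z‖ := by gcongr
    _ = _ := by
      rw [div_pow, mul_pow, ← Real.exp_nat_mul, show (N:ℝ) * (π / N * |z.im|) = π * |z.im| by
        field_simp, div_pow, div_pow, pow_succ]
      field_simp

lemma ker_bound' {N : ℕ} (hN : 1 ≤ N) {s : ℝ} (hs : s ≤ (N + 1) / 2) {z : ℂ}
    (hz : 1 ≤ |z.im|) :
    ‖ker N z‖ ≤ (N / π) ^ N * Real.exp (π * |z.im|) * (1 + z.re ^ 2) ^ (-s) := by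
  have hz0 : z ≠ 0 := by
    rintro rfl
    norm_num at hz
  refine (ker_bound hN hz0).trans ?_
  rw [div_eq_mul_inv]
  gcongr
  rw [Real.rpow_neg (by positivity)]
  gcongr
  have h1 : 1 + z.re ^ 2 ≤ ‖z‖ ^ 2 := by
    rw [Complex.sq_norm, Complex.normSq_apply]
    have : 1 ≤ z.im ^ 2 := by
      rw [← sq_abs]; nlinarith
    nlinarith
  calc (1 + z.re ^ 2) ^ s ≤ (1 + z.re ^ 2) ^ (((N:ℝ) + 1) / 2) :=
        Real.rpow_le_rpow_of_exponent_le (by nlinarith [sq_nonneg z.re]) hs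
    _ ≤ (‖z‖ ^ 2) ^ (((N:ℝ) + 1) / 2) := by gcongr
    _ = ‖z‖ ^ (N + 1) := by
      rw [← Real.rpow_natCast, ← Real.rpow_mul (norm_nonneg _), ← Real.rpow_natCast]
      congr 1
      push_cast
      ring

/-- Basic quadratic kernel bound. -/
lemma ker_bound1 {N : ℕ} (hN : 1 ≤ N) {z : ℂ} (hz : 1 ≤ |z.im|) :
    ‖ker N z‖ ≤ (N / π) ^ N * Real.exp (π * |z.im|) * (1 + z.re ^ 2)⁻¹ := by
  have := ker_bound' hN (s := 1) (by
    have : (1:ℝ) ≤ N := by exact_mod_cast hN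
    linarith) hz
  rwa [Real.rpow_neg_one] at this

/-- The integrand on the line of height `η`. -/
noncomputable def lineF (N : ℕ) (f : ℂ → ℂ) (z : ℂ) (η t : ℝ) : ℂ :=
  f (t + η * Complex.I) * Complex.exp (-(π * Complex.I * (t + η * Complex.I))) *
    ker N (t + η * Complex.I - z)

lemma norm_exp_line (t η : ℝ) :
    ‖Complex.exp (-(π * Complex.I * (t + η * Complex.I)))‖ = Real.exp (π * η) := by
  rw [Complex.norm_exp]
  simp

lemma lineF_bound {N : ℕ} (hN : 1 ≤ N) {f : ℂ → ℂ} {B : ℝ} (hB0 : 0 ≤ B)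
    (hB : ∀ z : ℂ, 1 ≤ z.im → ‖f z‖ ≤ B) {z : ℂ} {η : ℝ} (hη : 1 ≤ η) (hηz : 1 ≤ η - z.im)
    (t : ℝ) : ‖lineF N f z η t‖ ≤
      B * (N / π) ^ N * Real.exp (π * (2 * η - z.im)) * (1 + (t - z.re) ^ 2)⁻¹ := by
  unfold lineF
  have h1 := ker_bound1 hN (z := t + η * Complex.I - z) (by
    simp; rw [abs_of_pos (by linarith)]; exact hηz)
  have h2 := hB (t + η * Complex.I) (by simpa using hη)
  rw [norm_mul, norm_mul, norm_exp_line]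
  have e1 : (t + η * Complex.I - z : ℂ).im = η - z.im := by simp
  have e2 : (t + η * Complex.I - z : ℂ).re = t - z.re := by simp
  rw [e1, e2, abs_of_pos (by linarith)] at h1
  calc _ ≤ B * Real.exp (π * η) *
        ((N / π) ^ N * Real.exp (π * (η - z.im)) * (1 + (t - z.re) ^ 2)⁻¹) := by gcongr
    _ = _ := by
      rw [show π * (2 * η - z.im) = π * η + π * (η - z.im) by ring, Real.exp_add]
      ring

lemma integrable_q (x : ℝ) : Integrable fun t : ℝ => (1 + (t - x) ^ 2)⁻¹ :=
  integrable_inv_one_add_sq.comp_sub_right x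

lemma integral_q (x : ℝ) : ∫ t : ℝ, (1 + (t - x) ^ 2)⁻¹ = π := by
  rw [integral_sub_right_eq_self (fun t : ℝ => (1 + t ^ 2)⁻¹) x, integral_univ_inv_one_add_sq]

lemma f_line_cont {f : ℂ → ℂ} (hf : DifferentiableOn ℂ f {z : ℂ | 0 < z.im}) {η : ℝ} (hη : 0 < η) :
    Continuous fun t : ℝ => f (t + η * Complex.I) := by
  refine hf.continuousOn.comp_continuous (by fun_prop) ?_
  intro t
  simpa using hη

lemma ker_line_cont (N : ℕ) {z : ℂ} {η : ℝ} (hηz : 1 ≤ η - z.im) :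
    Continuous fun t : ℝ => ker N (t + η * Complex.I - z) := by
  rw [continuous_iff_continuousAt]
  intro t
  have h : (t + η * Complex.I - z : ℂ) ≠ 0 := by
    intro h
    have := congrArg Complex.im h
    simp at this
    linarith
  exact ContinuousAt.comp (f := fun t : ℝ => (t + η * Complex.I - z : ℂ))
    (ker_differentiableAt N h).continuousAt (by fun_prop)

lemma lineF_cont (N : ℕ) {f : ℂ → ℂ} (hf : DifferentiableOn ℂ f {z : ℂ | 0 < z.im}) {z : ℂ} {η : ℝ}
    (hη : 0 < η) (hηz : 1 ≤ η - z.im) : Continuous (lineF N f z η) := by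
  unfold lineF
  exact ((f_line_cont hf hη).mul (by fun_prop)).mul (ker_line_cont N hηz)

lemma lineF_integrable {N : ℕ} (hN : 1 ≤ N) {f : ℂ → ℂ}
    (hf : DifferentiableOn ℂ f {z : ℂ | 0 < z.im}) {B : ℝ} (hB0 : 0 ≤ B)
    (hB : ∀ z : ℂ, 1 ≤ z.im → ‖f z‖ ≤ B) {z : ℂ} {η : ℝ} (hη : 1 ≤ η) (hηz : 1 ≤ η - z.im) :
    Integrable (lineF N f z η) := by
  refine ((integrable_q z.re).const_mul _).mono'
    (lineF_cont N hf (by linarith) hηz).aestronglyMeasurable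
    (Filter.Eventually.of_forall fun t => lineF_bound hN hB0 hB hη hηz t)

lemma lineF_norm_integral {N : ℕ} (hN : 1 ≤ N) {f : ℂ → ℂ} {B : ℝ} (hB0 : 0 ≤ B)
    (hB : ∀ z : ℂ, 1 ≤ z.im → ‖f z‖ ≤ B) {z : ℂ} {η : ℝ} (hη : 1 ≤ η) (hηz : 1 ≤ η - z.im) :
    ‖∫ t, lineF N f z η t‖ ≤ B * (N / π) ^ N * Real.exp (π * (2 * η - z.im)) * π := by
  have := norm_integral_le_of_norm_le ((integrable_q z.re).const_mul _)
    (Filter.Eventually.of_forall fun t => lineF_bound hN hB0 hB hη hηz t)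
  rwa [integral_const_mul, integral_q] at this

lemma lineF_shift {N : ℕ} (hN : 1 ≤ N) {f : ℂ → ℂ}
    (hf : DifferentiableOn ℂ f {z : ℂ | 0 < z.im}) {B : ℝ} (hB0 : 0 ≤ B)
    (hB : ∀ z : ℂ, 1 ≤ z.im → ‖f z‖ ≤ B) {z : ℂ} {η₁ η₂ : ℝ} (hη : 1 ≤ η₁) (hηz : 1 ≤ η₁ - z.im)
    (h12 : η₁ ≤ η₂) : ∫ t, lineF N f z η₁ t = ∫ t, lineF N f z η₂ t := by
  have key := shift_line (c₁ := η₁) (c₂ := η₂) (x₀ := z.re)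
    (B := B * (N / π) ^ N * Real.exp (π * (2 * η₂ - z.im)))
    (G := fun w => f w * Complex.exp (-(π * Complex.I * w)) * ker N (w - z)) h12 ?_
    (lineF_integrable hN hf hB0 hB hη hηz)
    (lineF_integrable hN hf hB0 hB (hη.trans h12) (by linarith)) ?_
  · exact key
  · rintro w ⟨hw1, hw2⟩
    have hw : 0 < w.im := by linarith
    have h1 : DifferentiableAt ℂ f w :=
      (hf w hw).differentiableAt ((isOpen_lt continuous_const Complex.continuous_im).mem_nhds hw)
    have h0 : w - z ≠ 0 := by
      intro h
      have := congrArg Complex.im h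
      simp at this
      linarith
    have h2 : DifferentiableAt ℂ (fun w => ker N (w - z)) w :=
      DifferentiableAt.comp (g := ker N) (f := fun w => w - z) w (ker_differentiableAt N h0)
        (by fun_prop)
    have h3 : DifferentiableAt ℂ (fun w : ℂ => Complex.exp (-(π * Complex.I * w))) w := by fun_prop
    exact ((h1.mul h3).mul h2).differentiableWithinAt
  · intro t s ht hs1 hs2
    have := lineF_bound (N := N) hN hB0 hB (z := z) (η := s) (hη.trans hs1) (by linarith) t
    refine this.trans ?_
    rw [div_eq_mul_inv _ |t - z.re|]
    gcongr
    rw [← sq_abs]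
    nlinarith

lemma ker_deriv_bound {N : ℕ} (hN : 1 ≤ N) {z : ℂ} (hz : 2 ≤ z.im) :
    ‖deriv (ker N) z‖ ≤ (N / π) ^ N * Real.exp (π * (z.im + 1)) * (3 * (1 + z.re ^ 2)⁻¹) := by
  have hne : ∀ w ∈ Metric.closedBall z 1, 1 ≤ w.im ∧ w.im ≤ z.im + 1 ∧ |w.re - z.re| ≤ 1 := by
    intro w hw
    rw [Metric.mem_closedBall, dist_eq_norm] at hw
    have h1 := (Complex.abs_im_le_norm (w - z)).trans hw
    have h2 := (Complex.abs_re_le_norm (w - z)).trans hw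
    simp only [Complex.sub_im, Complex.sub_re] at h1 h2
    rw [abs_le] at h1
    exact ⟨by linarith, by linarith, h2⟩
  have := Complex.norm_deriv_le_of_forall_mem_sphere_norm_le (f := ker N) (c := z) (R := 1)
    (C := (N / π) ^ N * Real.exp (π * (z.im + 1)) * (3 * (1 + z.re ^ 2)⁻¹)) one_pos ?_ ?_
  · simpa using this
  · apply DifferentiableOn.diffContOnCl
    intro w hw
    rw [closure_ball _ one_ne_zero] at hw
    refine (ker_differentiableAt N ?_).differentiableWithinAt
    rintro rfl
    have := (hne 0 hw).1
    norm_num at this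
  · intro w hw
    obtain ⟨h1, h2, h3⟩ := hne w (Metric.sphere_subset_closedBall hw)
    have hb := ker_bound1 hN (z := w) (by rw [abs_of_pos (by linarith)]; exact h1)
    rw [abs_of_pos (by linarith)] at hb
    refine hb.trans ?_
    gcongr
    rw [← div_eq_mul_inv, le_div_iff₀ (by positivity), inv_mul_le_iff₀ (by positivity)]
    rw [abs_le] at h3
    nlinarith [sq_nonneg (2 * w.re - z.re), sq_nonneg (w.re - z.re), sq_nonneg (w.re)]

lemma lineF_differentiableAt {N : ℕ} (hN : 1 ≤ N) {f : ℂ → ℂ}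
    (hf : DifferentiableOn ℂ f {z : ℂ | 0 < z.im}) {B : ℝ} (hB0 : 0 ≤ B)
    (hB : ∀ z : ℂ, 1 ≤ z.im → ‖f z‖ ≤ B) {z₀ : ℂ} {η : ℝ} (hη : 1 ≤ η) (hηz : 3 ≤ η - z₀.im) :
    DifferentiableAt ℂ (fun z => ∫ t, lineF N f z η t) z₀ := by
  have hball : ∀ z ∈ Metric.ball z₀ 1, |z.im - z₀.im| ≤ 1 ∧ |z.re - z₀.re| ≤ 1 := by
    intro z hz
    rw [Metric.mem_ball, dist_eq_norm] at hz
    have h1 := (Complex.abs_im_le_norm (z - z₀)).trans hz.le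
    have h2 := (Complex.abs_re_le_norm (z - z₀)).trans hz.le
    exact ⟨by simpa using h1, by simpa using h2⟩
  have key := hasDerivAt_integral_of_dominated_loc_of_deriv_le (μ := volume) (𝕜 := ℂ)
    (F := fun z t => lineF N f z η t) (x₀ := z₀) (s := Metric.ball z₀ 1)
    (F' := fun z t => f (t + η * Complex.I) * Complex.exp (-(π * Complex.I * (t + η * Complex.I)))
      * (-deriv (ker N) (t + η * Complex.I - z)))
    (bound := fun t => B * Real.exp (π * η) * ((N / π) ^ N * Real.exp (π * (η - z₀.im + 2)) * 9)
      * (1 + (t - z₀.re) ^ 2)⁻¹)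
    (Metric.ball_mem_nhds _ one_pos) ?_ (lineF_integrable hN hf hB0 hB hη (by linarith)) ?_ ?_
    ((integrable_q z₀.re).const_mul _) ?_
  · exact key.2.differentiableAt
  · filter_upwards [Metric.ball_mem_nhds z₀ one_pos] with z hz
    have := (hball z hz).1
    rw [abs_le] at this
    exact (lineF_cont N hf (by linarith) (by linarith)).aestronglyMeasurable
  · refine Measurable.aestronglyMeasurable ?_
    refine (((f_line_cont hf (by linarith)).measurable).mul ?_).mul ?_
    · exact Continuous.measurable (by fun_prop)
    · exact ((measurable_deriv (ker N)).comp (Continuous.measurable (by fun_prop))).neg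
  · refine Filter.Eventually.of_forall fun t z hz => ?_
    obtain ⟨h1, h2⟩ := hball z hz
    rw [abs_le] at h1 h2
    have hd := ker_deriv_bound hN (z := t + η * Complex.I - z) (by simp; linarith)
    have e1 : (t + η * Complex.I - z : ℂ).im = η - z.im := by simp
    have e2 : (t + η * Complex.I - z : ℂ).re = t - z.re := by simp
    rw [e1, e2] at hd
    rw [norm_mul, norm_mul, norm_exp_line, norm_neg]
    have hfB := hB (t + η * Complex.I) (by simpa using hη)
    have hq : (1 + (t - z.re) ^ 2)⁻¹ ≤ 3 * (1 + (t - z₀.re) ^ 2)⁻¹ := by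
      rw [← div_eq_mul_inv, le_div_iff₀ (by positivity), inv_mul_le_iff₀ (by positivity)]
      nlinarith [sq_nonneg ((t - z.re) - (z.re - z₀.re))]
    calc _ ≤ B * Real.exp (π * η) * ((N / π) ^ N * Real.exp (π * (η - z₀.im + 2)) *
            (3 * (3 * (1 + (t - z₀.re) ^ 2)⁻¹))) := by
          have he : Real.exp (π * (η - z.im + 1)) ≤ Real.exp (π * (η - z₀.im + 2)) := by
            rw [Real.exp_le_exp]
            exact mul_le_mul_of_nonneg_left (by linarith) Real.pi_pos.le
          gcongr
          refine hd.trans ?_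
          gcongr
      _ = _ := by ring
  · refine Filter.Eventually.of_forall fun t z hz => ?_
    obtain ⟨h1, h2⟩ := hball z hz
    rw [abs_le] at h1 h2
    have h0 : (t + η * Complex.I - z : ℂ) ≠ 0 := by
      intro h
      have := congrArg Complex.im h
      simp at this
      linarith
    unfold lineF
    refine HasDerivAt.const_mul _ ?_
    have := (ker_differentiableAt N h0).hasDerivAt.comp z ((hasDerivAt_id z).const_sub (t + η * Complex.I : ℂ))
    simpa [Function.comp_def] using this

/-- The operator. -/
noncomputable def Top (N : ℕ) (f : ℂ → ℂ) (z : ℂ) : ℂ := ∫ t, lineF N f z (max 0 z.im + 1) t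

lemma Top_differentiable {N : ℕ} (hN : 1 ≤ N) {f : ℂ → ℂ}
    (hf : DifferentiableOn ℂ f {z : ℂ | 0 < z.im}) {B : ℝ} (hB0 : 0 ≤ B)
    (hB : ∀ z : ℂ, 1 ≤ z.im → ‖f z‖ ≤ B) : Differentiable ℂ (Top N f) := by
  intro z₀
  have h := lineF_differentiableAt hN hf hB0 hB (z₀ := z₀) (η := max 0 z₀.im + 3)
    (by linarith [le_max_left 0 z₀.im]) (by linarith [le_max_right 0 z₀.im])
  refine h.congr_of_eventuallyEq ?_
  filter_upwards [Metric.ball_mem_nhds z₀ one_pos] with z hz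
  rw [Metric.mem_ball, dist_eq_norm] at hz
  have h1 := (Complex.abs_im_le_norm (z - z₀)).trans hz.le
  rw [Complex.sub_im, abs_le] at h1
  refine lineF_shift hN hf hB0 hB (by linarith [le_max_left 0 z.im])
    (by linarith [le_max_right 0 z.im]) ?_
  have : max 0 z.im ≤ max 0 z₀.im + 1 := by
    apply max_le
    · linarith [le_max_left 0 z₀.im]
    · linarith [le_max_right 0 z₀.im]
  linarith

lemma Top_bound {N : ℕ} (hN : 1 ≤ N) {f : ℂ → ℂ} {B : ℝ} (hB0 : 0 ≤ B)
    (hB : ∀ z : ℂ, 1 ≤ z.im → ‖f z‖ ≤ B) (z : ℂ) :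
    ‖Top N f z‖ ≤ B * (N / π) ^ N * Real.exp (2 * π) * π * Real.exp (π * ‖z‖) := by
  have := lineF_norm_integral hN hB0 hB (z := z) (η := max 0 z.im + 1)
    (by linarith [le_max_left 0 z.im]) (by linarith [le_max_right 0 z.im])
  refine this.trans ?_
  have e : Real.exp (π * (2 * (max 0 z.im + 1) - z.im)) ≤ Real.exp (2 * π) * Real.exp (π * ‖z‖) := by
    rw [← Real.exp_add, Real.exp_le_exp]
    have h1 := Complex.abs_im_le_norm z
    have h2 : 2 * max 0 z.im - z.im ≤ |z.im| := by
      rcases le_total 0 z.im with h | h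
      · rw [max_eq_right h, abs_of_nonneg h]; linarith
      · rw [max_eq_left h, abs_of_nonpos h]; linarith
    nlinarith [Real.pi_pos]
  calc _ ≤ B * (N / π) ^ N * (Real.exp (2 * π) * Real.exp (π * ‖z‖)) * π := by gcongr
    _ = _ := by ring

end CompLemma

namespace CompLemma

lemma isOpen_upper : IsOpen {z : ℂ | 0 < z.im} := isOpen_lt continuous_const Complex.continuous_im

/-- Pointwise bound from an area integral. -/
lemma sup_bound {p : ℝ} (hp : 0 < p) {f : ℂ → ℂ} {U : Set ℂ} (hU : IsOpen U)
    (hf : DifferentiableOn ℂ f U) {A : ℝ≥0∞} (hA : A < ⊤) :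
    ∃ B : ℝ, 0 ≤ B ∧ ∀ z, Metric.ball z (1 / 2) ⊆ U →
      ∫⁻ w in Metric.ball z (1 / 2), ‖f w‖ₑ ^ p ≤ A → ‖f z‖ ≤ B := by
  set c : ℝ≥0∞ := ENNReal.ofReal (π * (1 / 2) ^ 2) with hc
  have hc0 : c ≠ 0 := by
    rw [hc]; simp; positivity
  have hct : c ≠ ⊤ := ENNReal.ofReal_ne_top
  refine ⟨((A / c) ^ (1 / p)).toReal, ENNReal.toReal_nonneg, fun z hz h => ?_⟩
  have h1 := (disc_submean hp (by norm_num) hU hf hz).trans h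
  have h2 : ‖f z‖ₑ ^ p ≤ A / c := by
    rw [ENNReal.le_div_iff_mul_le (Or.inl hc0) (Or.inl hct), mul_comm]
    exact h1
  have h3 : ‖f z‖ₑ ≤ (A / c) ^ (1 / p) := by
    rw [one_div, ENNReal.le_rpow_inv_iff hp]
    exact h2
  have hfin : (A / c) ^ (1 / p) ≠ ⊤ := by
    apply ENNReal.rpow_ne_top_of_nonneg (by positivity)
    exact (ENNReal.div_lt_top hA.ne hc0).ne
  have := ENNReal.toReal_mono hfin h3
  simpa using this

lemma Hp_bounded {p : ℝ} (hp : 0 < p) {f : ℂ → ℂ}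
    (hf : DifferentiableOn ℂ f {z : ℂ | 0 < z.im}) {S : ℝ≥0∞} (hS : S < ⊤)
    (h : ∀ y : ℝ, 0 < y → ∫⁻ x : ℝ, ‖f (x + y * Complex.I)‖ₑ ^ p ≤ S) :
    ∃ B : ℝ, 0 ≤ B ∧ ∀ z : ℂ, 1 ≤ z.im → ‖f z‖ ≤ B := by
  obtain ⟨B, hB0, hB⟩ := sup_bound hp isOpen_upper hf hS
  refine ⟨B, hB0, fun z hz => ?_⟩
  have hsub : Metric.ball z (1 / 2) ⊆ {w : ℂ | z.im - 1 / 2 < w.im ∧ w.im < z.im + 1 / 2} := by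
    intro w hw
    rw [Metric.mem_ball, dist_eq_norm] at hw
    have h1 := (Complex.abs_im_le_norm (w - z)).trans_lt hw
    rw [Complex.sub_im, abs_lt] at h1
    exact ⟨by linarith, by linarith⟩
  have hsub' : Metric.ball z (1 / 2) ⊆ {w : ℂ | 0 < w.im} := fun w hw => by
    have := (hsub hw).1
    show 0 < w.im
    linarith
  refine hB z hsub' ?_
  have e := strip_lintegral (measurable_indicator_of_diff isOpen_upper hf p)
    (a := z.im - 1 / 2) (b := z.im + 1 / 2) (S := S) (by
      intro y hy _ _
      have hy0 : 0 < y := by linarith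
      refine le_trans (le_of_eq ?_) (h y hy0)
      refine lintegral_congr fun x => ?_
      rw [Set.indicator_of_mem]
      simpa using hy0)
  rw [show z.im + 1 / 2 - (z.im - 1 / 2) = 1 by ring, ENNReal.ofReal_one, one_mul] at e
  refine le_trans ?_ ((lintegral_mono_set hsub).trans e)
  refine le_of_eq (setLIntegral_congr_fun measurableSet_ball fun w hw => ?_)
  rw [Set.indicator_of_mem (hsub' hw)]

/-- `(1+u^2)⁻¹` as an extended nonnegative real. -/
noncomputable def qE (u : ℝ) : ℝ≥0∞ := ENNReal.ofReal ((1 + u ^ 2)⁻¹)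

lemma qE_measurable : Measurable qE := by
  unfold qE
  fun_prop

lemma lintegral_qE (x : ℝ) : ∫⁻ t : ℝ, qE (t - x) = ENNReal.ofReal π := by
  unfold qE
  rw [← ofReal_integral_eq_lintegral_ofReal (integrable_q x)
    (Filter.Eventually.of_forall fun t => by positivity), integral_q]

lemma qE_le {x t s : ℝ} (h : |s - t| ≤ 1) : qE (x - t) ≤ 3 * qE (x - s) := by
  unfold qE
  rw [← ENNReal.ofReal_ofNat 3, ← ENNReal.ofReal_mul (by norm_num)]
  apply ENNReal.ofReal_le_ofReal
  rw [← div_eq_mul_inv, le_div_iff₀ (by positivity), inv_mul_le_iff₀ (by positivity)]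
  rw [abs_le] at h
  nlinarith [sq_nonneg ((x - t) + (s - t))]

/-- The key `L^p` estimate. -/
lemma Top_Lp {p : ℝ} (hp : 0 < p) (hp1 : p < 1) {N : ℕ} (hN : 1 ≤ N) (hNp : 1 / p ≤ (N + 1) / 2)
    {f : ℂ → ℂ} (hf : DifferentiableOn ℂ f {z : ℂ | 0 < z.im}) {S : ℝ≥0∞}
    (h : ∀ y : ℝ, 0 < y → ∫⁻ x : ℝ, ‖f (x + y * Complex.I)‖ₑ ^ p ≤ S) :
    ∫⁻ x : ℝ, ‖Top N f x‖ₑ ^ p ≤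
      ENNReal.ofReal ((N / π) ^ N * Real.exp (2 * π)) ^ p *
        ((ENNReal.ofReal (π * (1 / 2) ^ 2))⁻¹ * 3 * 2 + 1) * ENNReal.ofReal π * S := by
  set K : ℝ≥0∞ := ENNReal.ofReal ((N / π) ^ N * Real.exp (2 * π)) with hK
  set c : ℝ≥0∞ := ENNReal.ofReal (π * (1 / 2) ^ 2) with hc
  have hc0 : c ≠ 0 := by
    rw [hc]; simp; positivity
  have hct : c ≠ ⊤ := ENNReal.ofReal_ne_top
  set U : Set ℂ := {z : ℂ | 0 < z.im} with hU
  set g : ℂ → ℝ≥0∞ := U.indicator (fun z => ‖f z‖ₑ ^ p) with hg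
  have hgm : Measurable g := measurable_indicator_of_diff isOpen_upper hf p
  have hline : ∀ t : ℝ, (t + (1:ℝ) * Complex.I : ℂ) ∈ U := fun t => by simp [hU]
  set strip : Set ℂ := {z : ℂ | 0 < z.im ∧ z.im < 2} with hstrip
  set W : ℝ → ℝ≥0∞ := fun x => ∫⁻ z in strip, g z * qE (x - z.re) with hW
  set V : ℝ → ℝ≥0∞ := fun x => ∫⁻ t : ℝ, ‖f (t + (1:ℝ) * Complex.I)‖ₑ ^ p * qE (x - t) with hV
  have hfm : Measurable fun t : ℝ => ‖f (t + (1:ℝ) * Complex.I)‖ₑ :=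
    (f_line_cont hf one_pos).measurable.enorm
  -- pointwise bound
  have hpt : ∀ x t : ℝ, ‖f (t + (1:ℝ) * Complex.I)‖ₑ ^ p * qE (x - t) ≤ c⁻¹ * 3 * W x := by
    intro x t
    have hsub : Metric.ball (t + (1:ℝ) * Complex.I : ℂ) (1 / 2) ⊆
        {w : ℂ | (0 < w.im ∧ w.im < 2) ∧ |w.re - t| ≤ 1} := by
      intro w hw
      rw [Metric.mem_ball, dist_eq_norm] at hw
      have h1 := (Complex.abs_im_le_norm _).trans_lt hw
      have h2 := (Complex.abs_re_le_norm _).trans_lt hw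
      simp at h1 h2
      rw [abs_lt] at h1
      exact ⟨⟨by linarith, by linarith⟩, by linarith⟩
    have hd := disc_submean hp (c := (t + (1:ℝ) * Complex.I : ℂ)) (r := 1 / 2) (by norm_num)
      isOpen_upper hf (fun w hw => (hsub hw).1.1)
    rw [← hc] at hd
    have h2 : c * ‖f (t + (1:ℝ) * Complex.I)‖ₑ ^ p * qE (x - t) ≤ 3 * W x := by
      calc _ ≤ (∫⁻ z in Metric.ball (t + (1:ℝ) * Complex.I : ℂ) (1 / 2), ‖f z‖ₑ ^ p) * qE (x - t) := by
            gcongr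
        _ = (∫⁻ z in Metric.ball (t + (1:ℝ) * Complex.I : ℂ) (1 / 2), g z) * qE (x - t) := by
            congr 1
            refine setLIntegral_congr_fun measurableSet_ball fun w hw => ?_
            have : w ∈ U := (hsub hw).1.1
            simp only [hg, Set.indicator_of_mem this]
        _ = ∫⁻ z in Metric.ball (t + (1:ℝ) * Complex.I : ℂ) (1 / 2), g z * qE (x - t) := by
            rw [lintegral_mul_const _ hgm]
        _ ≤ ∫⁻ z in Metric.ball (t + (1:ℝ) * Complex.I : ℂ) (1 / 2), 3 * (g z * qE (x - z.re)) := by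
            refine setLIntegral_mono' measurableSet_ball fun w hw => ?_
            calc g w * qE (x - t) ≤ g w * (3 * qE (x - w.re)) := by
                  gcongr
                  exact qE_le (hsub hw).2
              _ = _ := by ring
        _ ≤ ∫⁻ z in strip, 3 * (g z * qE (x - z.re)) :=
            lintegral_mono_set fun w hw => (hsub hw).1
        _ = 3 * W x := by
            rw [lintegral_const_mul]
            exact hgm.mul (qE_measurable.comp (by fun_prop))
    calc ‖f (t + (1:ℝ) * Complex.I)‖ₑ ^ p * qE (x - t)
        = c⁻¹ * (c * ‖f (t + (1:ℝ) * Complex.I)‖ₑ ^ p * qE (x - t)) := by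
          rw [mul_assoc c, ← mul_assoc, ENNReal.inv_mul_cancel hc0 hct, one_mul]
      _ ≤ c⁻¹ * (3 * W x) := by gcongr
      _ = _ := by ring
  have hmain : ∀ x : ℝ, ‖Top N f x‖ₑ ^ p ≤ K ^ p * (V x + c⁻¹ * 3 * W x) := by
    intro x
    set a : ℝ → ℝ≥0∞ := fun t => ‖f (t + (1:ℝ) * Complex.I)‖ₑ * qE (x - t) ^ (1 / p) with ha
    have hap : ∀ t, a t ^ p = ‖f (t + (1:ℝ) * Complex.I)‖ₑ ^ p * qE (x - t) := by
      intro t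
      simp only [ha]
      rw [ENNReal.mul_rpow_of_nonneg _ _ hp.le, ← ENNReal.rpow_mul, one_div_mul_cancel hp.ne',
        ENNReal.rpow_one]
    set Z := c⁻¹ * 3 * W x with hZ
    have haZ : ∀ t, a t ≤ a t ^ p * Z ^ ((1 - p) / p) := by
      intro t
      have h1 : a t = a t ^ p * a t ^ (1 - p) := by
        rw [← ENNReal.rpow_add_of_nonneg _ _ hp.le (by linarith)]
        simp
      have h2 : a t ^ (1 - p) ≤ Z ^ ((1 - p) / p) := by
        have h3 : a t ^ p ≤ Z := by rw [hap]; exact hpt x t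
        have h4 := ENNReal.rpow_le_rpow h3 (show 0 ≤ (1 - p) / p by
          apply div_nonneg <;> linarith)
        rw [← ENNReal.rpow_mul, mul_div_cancel₀ _ hp.ne'] at h4
        exact h4
      calc a t = a t ^ p * a t ^ (1 - p) := h1
        _ ≤ _ := by gcongr
    have hT : ‖Top N f x‖ₑ ≤ K * ∫⁻ t, a t := by
      unfold Top
      refine (enorm_integral_le_lintegral_enorm _).trans ?_
      rw [← lintegral_const_mul]
      · refine lintegral_mono fun t => ?_
        have e0 : max 0 (x:ℂ).im + 1 = 1 := by simp
        rw [e0]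
        unfold lineF
        have e1 : (t + (1:ℝ) * Complex.I - x : ℂ).im = 1 := by simp
        have e2 : (t + (1:ℝ) * Complex.I - x : ℂ).re = t - x := by simp
        have hk := ker_bound' hN hNp (z := t + (1:ℝ) * Complex.I - x) (by rw [e1]; simp)
        rw [e1, e2] at hk
        rw [enorm_mul, enorm_mul]
        have hexp : ‖Complex.exp (-(π * Complex.I * (t + (1:ℝ) * Complex.I)))‖ₑ
            = ENNReal.ofReal (Real.exp π) := by
          rw [← ofReal_norm, norm_exp_line, mul_one]
        have hk' : ‖ker N (t + (1:ℝ) * Complex.I - x)‖ₑ ≤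
            ENNReal.ofReal ((N / π) ^ N * Real.exp π) * qE (x - t) ^ (1 / p) := by
          rw [← ofReal_norm]
          refine (ENNReal.ofReal_le_ofReal hk).trans (le_of_eq ?_)
          unfold qE
          rw [ENNReal.ofReal_rpow_of_nonneg (by positivity) (by positivity),
            ← ENNReal.ofReal_mul (by positivity), Real.inv_rpow (by positivity),
            ← Real.rpow_neg (by positivity), show (x - t) ^ 2 = (t - x) ^ 2 by ring]
          simp
        rw [hexp]
        calc _ ≤ ‖f (t + (1:ℝ) * Complex.I)‖ₑ * ENNReal.ofReal (Real.exp π) *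
              (ENNReal.ofReal ((N / π) ^ N * Real.exp π) * qE (x - t) ^ (1 / p)) := by gcongr
          _ = (ENNReal.ofReal (Real.exp π) * ENNReal.ofReal ((N / π) ^ N * Real.exp π)) * a t := by
              simp only [ha]; ring
          _ = K * a t := by
              rw [← ENNReal.ofReal_mul (by positivity), hK]
              congr 2
              rw [two_mul, Real.exp_add]; ring
      · exact hfm.mul ((qE_measurable.comp (by fun_prop)).pow_const _)
    have hintg : ∫⁻ t, a t ≤ V x * Z ^ ((1 - p) / p) := by
      refine (lintegral_mono haZ).trans ?_
      rw [lintegral_mul_const]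
      · gcongr
        refine le_of_eq (lintegral_congr fun t => hap t)
      · exact (hfm.mul ((qE_measurable.comp (by fun_prop)).pow_const _)).pow_const _
    calc ‖Top N f x‖ₑ ^ p ≤ (K * (V x * Z ^ ((1 - p) / p))) ^ p := by
          apply ENNReal.rpow_le_rpow _ hp.le
          exact hT.trans (by gcongr)
      _ = K ^ p * (V x ^ p * Z ^ (1 - p)) := by
          rw [ENNReal.mul_rpow_of_nonneg _ _ hp.le, ENNReal.mul_rpow_of_nonneg _ _ hp.le,
            ← ENNReal.rpow_mul, div_mul_cancel₀ _ hp.ne']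
      _ ≤ K ^ p * ((V x + Z) ^ p * (V x + Z) ^ (1 - p)) := by
          gcongr
          · exact le_self_add
          · exact le_add_self
      _ = K ^ p * (V x + Z) := by
          rw [← ENNReal.rpow_add_of_nonneg _ _ hp.le (by linarith)]
          simp
  have hVi : ∫⁻ x, V x ≤ ENNReal.ofReal π * S := by
    simp only [hV]
    rw [lintegral_lintegral_swap]
    · calc _ = ∫⁻ t : ℝ, ‖f (t + (1:ℝ) * Complex.I)‖ₑ ^ p * ENNReal.ofReal π := by
            refine lintegral_congr fun t => ?_
            have hm : Measurable fun x : ℝ => qE (x - t) := qE_measurable.comp (by fun_prop)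
            rw [lintegral_const_mul _ hm, lintegral_qE]
        _ = (∫⁻ t : ℝ, ‖f (t + (1:ℝ) * Complex.I)‖ₑ ^ p) * ENNReal.ofReal π := by
            rw [lintegral_mul_const _ (hfm.pow_const _)]
        _ ≤ S * ENNReal.ofReal π := by
            gcongr
            exact h 1 one_pos
        _ = _ := mul_comm _ _
    · refine Measurable.aemeasurable ?_
      exact ((hfm.pow_const p).comp measurable_snd).mul (qE_measurable.comp (by fun_prop))
  have hWi : ∫⁻ x, W x ≤ ENNReal.ofReal π * (2 * S) := by
    simp only [hW]
    rw [lintegral_lintegral_swap]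
    · have hs := strip_lintegral hgm (a := 0) (b := 2) (S := S) (by
        intro y hy _ _
        refine le_trans (le_of_eq ?_) (h y hy)
        refine lintegral_congr fun x => ?_
        rw [hg, Set.indicator_of_mem]
        simpa [hU] using hy)
      calc _ = ∫⁻ z in strip, g z * ENNReal.ofReal π := by
            refine lintegral_congr fun z => ?_
            have hm : Measurable fun x : ℝ => qE (x - z.re) := qE_measurable.comp (by fun_prop)
            rw [lintegral_const_mul _ hm, lintegral_qE]
        _ = (∫⁻ z in strip, g z) * ENNReal.ofReal π := by
            rw [lintegral_mul_const _ hgm]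
        _ ≤ (ENNReal.ofReal (2 - 0) * S) * ENNReal.ofReal π := by
            gcongr
        _ = _ := by
            rw [mul_comm, sub_zero, ENNReal.ofReal_ofNat]
    · refine Measurable.aemeasurable ?_
      exact (hgm.comp measurable_snd).mul (qE_measurable.comp (by fun_prop))
  have hVm : Measurable V := by
    simp only [hV]
    refine Measurable.lintegral_prod_right' (f := fun q : ℝ × ℝ =>
      ‖f (q.2 + (1:ℝ) * Complex.I)‖ₑ ^ p * qE (q.1 - q.2)) ?_
    exact ((hfm.pow_const p).comp measurable_snd).mul (qE_measurable.comp (by fun_prop))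
  calc _ ≤ ∫⁻ x, K ^ p * (V x + c⁻¹ * 3 * W x) := lintegral_mono hmain
    _ = K ^ p * (∫⁻ x, V x + c⁻¹ * 3 * W x) := by
        rw [lintegral_const_mul' _ _ (ENNReal.rpow_ne_top_of_nonneg hp.le ENNReal.ofReal_ne_top)]
    _ = K ^ p * ((∫⁻ x, V x) + c⁻¹ * 3 * ∫⁻ x, W x) := by
        rw [lintegral_add_left hVm, lintegral_const_mul']
        exact ENNReal.mul_ne_top (ENNReal.inv_ne_top.mpr hc0) (by simp)
    _ ≤ K ^ p * (ENNReal.ofReal π * S + c⁻¹ * 3 * (ENNReal.ofReal π * (2 * S))) := by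
        gcongr
    _ = _ := by ring

end CompLemma

namespace CompLemma

lemma two_i_norm_bound (u : ℝ) :
    ‖2 * Complex.I / ((u + 3 * Complex.I) * (u + Complex.I))‖ ≤ 2 * (1 + u ^ 2)⁻¹ := by
  have h1 : 1 + u ^ 2 ≤ ‖(u + 3 * Complex.I : ℂ)‖ * ‖(u + Complex.I : ℂ)‖ := by
    have e1 : ‖(u + 3 * Complex.I : ℂ)‖ ^ 2 = u ^ 2 + 9 := by
      rw [Complex.sq_norm, Complex.normSq_apply]; simp; ring
    have e2 : ‖(u + Complex.I : ℂ)‖ ^ 2 = u ^ 2 + 1 := by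
      rw [Complex.sq_norm, Complex.normSq_apply]; simp; ring
    refine le_of_sq_le_sq ?_ (by positivity)
    rw [mul_pow, e1, e2]
    nlinarith [sq_nonneg u]
  rw [norm_div, norm_mul, norm_mul, Complex.norm_I, mul_one, div_eq_mul_inv, Complex.norm_ofNat]
  gcongr

open Filter Topology in
lemma integral_top_zero :
    ∫ u : ℝ, 2 * Complex.I / ((u + 3 * Complex.I) * (u + Complex.I)) = 0 := by
  have n3 : ∀ u : ℝ, (u + 3 * Complex.I : ℂ) ≠ 0 := fun u h => by
    have := congrArg Complex.im h
    simp at this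
  have n1 : ∀ u : ℝ, (u + Complex.I : ℂ) ≠ 0 := fun u h => by
    have := congrArg Complex.im h
    simp at this
  have hcont : Continuous fun u : ℝ => 2 * Complex.I / ((u + 3 * Complex.I) * (u + Complex.I)) := by
    refine Continuous.div continuous_const (by fun_prop) fun u => mul_ne_zero (n3 u) (n1 u)
  have hintg : Integrable fun u : ℝ => 2 * Complex.I / ((u + 3 * Complex.I) * (u + Complex.I)) :=
    (integrable_inv_one_add_sq.const_mul 2).mono' hcont.aestronglyMeasurable
      (Eventually.of_forall two_i_norm_bound)
  have hre : ∀ u : ℝ, ((u + Complex.I) / (u + 3 * Complex.I) : ℂ) ∈ Complex.slitPlane := by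
    intro u
    left
    rw [Complex.div_re]
    simp only [Complex.add_re, Complex.ofReal_re, Complex.I_re, Complex.mul_re, Complex.add_im,
      Complex.ofReal_im, Complex.I_im, Complex.mul_im]
    simp
    rw [← add_div]
    apply div_pos
    · nlinarith [sq_nonneg u]
    · exact Complex.normSq_pos.mpr (n3 u)
  have hderiv : ∀ u : ℝ, HasDerivAt (fun u : ℝ => Complex.log ((u + Complex.I) / (u + 3 * Complex.I)))
      (2 * Complex.I / ((u + 3 * Complex.I) * (u + Complex.I))) u := by
    intro u
    have h0 : HasDerivAt (fun u : ℝ => (u : ℂ)) 1 u := Complex.ofRealCLM.hasDerivAt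
    have h1 := ((h0.add_const Complex.I).div (h0.add_const (3 * Complex.I)) (n3 u)).clog_real (hre u)
    have e : (1 * (u + 3 * Complex.I) - (u + Complex.I) * 1) / (u + 3 * Complex.I) ^ 2
        / ((u + Complex.I) / (u + 3 * Complex.I))
        = 2 * Complex.I / ((u + 3 * Complex.I) * (u + Complex.I)) := by
      have hn3 := n3 u
      have hn1 := n1 u
      field_simp [hn3, hn1]
      ring
    rw [← e]
    exact h1
  have hlim : ∀ l : Filter ℝ, Tendsto (fun u : ℝ => |u|) l atTop →
      Tendsto (fun u : ℝ => Complex.log ((u + Complex.I) / (u + 3 * Complex.I))) l (𝓝 0) := by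
    intro l hl
    have h1 : Tendsto (fun u : ℝ => (2 * Complex.I / (u + 3 * Complex.I) : ℂ)) l (𝓝 0) := by
      have hz : Tendsto (fun u : ℝ => 2 / |u|) l (𝓝 0) := tendsto_const_nhds.div_atTop hl
      refine squeeze_zero_norm' ?_ hz
      filter_upwards [hl.eventually_ge_atTop 1] with u hu
      rw [norm_div, norm_mul, Complex.norm_I, mul_one, Complex.norm_ofNat]
      gcongr
      have := Complex.abs_re_le_norm (u + 3 * Complex.I)
      simpa using this
    have h2 : Tendsto (fun u : ℝ => ((u + Complex.I) / (u + 3 * Complex.I) : ℂ)) l (𝓝 1) := by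
      have := (tendsto_const_nhds (x := (1:ℂ))).sub h1
      rw [sub_zero] at this
      refine this.congr fun u => ?_
      have hn3 := n3 u
      rw [eq_div_iff hn3, sub_mul, div_mul_cancel₀ _ hn3]
      ring
    have h3 := (continuousAt_clog (x := 1) (by simp)).tendsto.comp h2
    simpa [Function.comp_def] using h3
  rw [integral_of_hasDerivAt_of_tendsto hderiv hintg (hlim _ tendsto_abs_atBot_atTop)
    (hlim _ tendsto_abs_atTop_atTop), sub_zero]

/-- The Cauchy formula on a strip, with the kernel `ker`. -/
lemma reproducing {N : ℕ} (hN : 1 ≤ N) {h : ℂ → ℂ} (hh : Differentiable ℂ h) {B : ℝ}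
    (hB : ∀ z : ℂ, |z.im| ≤ 1 → ‖h z‖ ≤ B) (x : ℝ) :
    (∫ t : ℝ, h (t + (-1 : ℝ) * Complex.I) * ker N (t + (-1 : ℝ) * Complex.I - x))
      - (∫ t : ℝ, h (t + (1 : ℝ) * Complex.I) * ker N (t + (1 : ℝ) * Complex.I - x))
      = 2 * π * Complex.I * h x := by
  have hB0 : 0 ≤ B := (norm_nonneg _).trans (hB 0 (by simp))
  set Nm : ℂ → ℂ := fun w => h w * Phi N (w - x) - h x * (2 * Complex.I / (w - x + 2 * Complex.I))
    with hNm
  have h2I : (2 * Complex.I : ℂ) ≠ 0 := by simp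
  have hNx : Nm x = 0 := by
    simp [hNm, Phi_zero]
  set G := dslope Nm (x : ℂ) with hGdef
  have hGne : ∀ w : ℂ, w ≠ x → G w = h w * ker N (w - x)
      - h x * (2 * Complex.I / ((w - x + 2 * Complex.I) * (w - x))) := by
    intro w hw
    have : w - x ≠ 0 := sub_ne_zero.mpr hw
    rw [hGdef, dslope_of_ne _ hw, slope_def_field, hNx, sub_zero, hNm]
    simp only [ker]
    rw [sub_div, mul_div_assoc, mul_div_assoc, div_div]
  have hopen : IsOpen {w : ℂ | -2 < w.im} := isOpen_lt continuous_const Complex.continuous_im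
  have hGd : DifferentiableOn ℂ G {w : ℂ | -2 < w.im} := by
    rw [hGdef, Complex.differentiableOn_dslope (hopen.mem_nhds (by simp))]
    intro w hw
    have hne : w - x + 2 * Complex.I ≠ 0 := by
      intro h0
      have := congrArg Complex.im h0
      simp at this
      have hw' : -2 < w.im := hw
      linarith
    have hP : DifferentiableAt ℂ (fun w => Phi N (w - x)) w :=
      DifferentiableAt.comp (g := Phi N) (f := fun w => w - (x:ℂ)) w (Phi_differentiable N _)
        (by fun_prop)
    have hq : DifferentiableAt ℂ (fun w : ℂ => 2 * Complex.I / (w - x + 2 * Complex.I)) w :=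
      DifferentiableAt.div (by fun_prop) (by fun_prop) hne
    exact (((hh w).mul hP).sub (hq.const_mul _)).differentiableWithinAt
  -- line functions
  have hσne : ∀ σ : ℝ, |σ| = 1 → ∀ t : ℝ, (t + σ * Complex.I : ℂ) - x ≠ 0 := by
    intro σ hσ t h0
    have := congrArg Complex.im h0
    simp at this
    rw [this] at hσ
    simp at hσ
  have hkint : ∀ σ : ℝ, |σ| = 1 → Integrable fun t : ℝ =>
      h (t + σ * Complex.I) * ker N (t + σ * Complex.I - x) := by
    intro σ hσ
    refine ((integrable_q x).const_mul (B * ((N / π) ^ N * Real.exp (π * 1)))).mono' ?_ ?_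
    · refine Continuous.aestronglyMeasurable (Continuous.mul ?_ ?_)
      · exact hh.continuous.comp (by fun_prop)
      · rw [continuous_iff_continuousAt]
        intro t
        exact ContinuousAt.comp (f := fun t : ℝ => (t + σ * Complex.I - x : ℂ))
          (ker_differentiableAt N (hσne σ hσ t)).continuousAt (by fun_prop)
    · refine Filter.Eventually.of_forall fun t => ?_
      have e1 : (t + σ * Complex.I - x : ℂ).im = σ := by simp
      have e2 : (t + σ * Complex.I - x : ℂ).re = t - x := by simp
      have hk := ker_bound1 hN (z := t + σ * Complex.I - x) (by rw [e1, hσ])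
      rw [e1, e2, hσ] at hk
      have hb := hB (t + σ * Complex.I) (by simp [hσ])
      rw [norm_mul, mul_assoc B]
      gcongr
  have hbot : ∀ t : ℝ, (2 * Complex.I / (((t + (-1:ℝ) * Complex.I : ℂ) - x + 2 * Complex.I)
      * ((t + (-1:ℝ) * Complex.I : ℂ) - x))) = 2 * Complex.I * (((1 + (t - x) ^ 2)⁻¹ : ℝ) : ℂ) := by
    intro t
    rw [div_eq_mul_inv]
    congr 1
    push_cast
    congr 1
    linear_combination (-1:ℂ) * Complex.I_sq
  have htop : ∀ t : ℝ, (2 * Complex.I / (((t + (1:ℝ) * Complex.I : ℂ) - x + 2 * Complex.I)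
      * ((t + (1:ℝ) * Complex.I : ℂ) - x))) =
      2 * Complex.I / ((((t - x : ℝ) : ℂ) + 3 * Complex.I) * (((t - x : ℝ) : ℂ) + Complex.I)) := by
    intro t
    congr 1
    push_cast
    ring
  have hIbot : Integrable fun t : ℝ => (2 * Complex.I / (((t + (-1:ℝ) * Complex.I : ℂ) - x
      + 2 * Complex.I) * ((t + (-1:ℝ) * Complex.I : ℂ) - x))) := by
    simp_rw [hbot]
    exact (integrable_q x).ofReal.const_mul _
  have hVbot : ∫ t : ℝ, (2 * Complex.I / (((t + (-1:ℝ) * Complex.I : ℂ) - x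
      + 2 * Complex.I) * ((t + (-1:ℝ) * Complex.I : ℂ) - x))) = 2 * Complex.I * π := by
    simp_rw [hbot]
    rw [integral_const_mul, integral_complex_ofReal, integral_q]
  have hItop : Integrable fun t : ℝ => (2 * Complex.I / (((t + (1:ℝ) * Complex.I : ℂ) - x
      + 2 * Complex.I) * ((t + (1:ℝ) * Complex.I : ℂ) - x))) := by
    refine ((integrable_q x).const_mul 2).mono' ?_ ?_
    · refine Continuous.aestronglyMeasurable (Continuous.div continuous_const (by fun_prop) ?_)
      intro t
      refine mul_ne_zero ?_ (hσne 1 (by simp) t)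
      intro h0
      have := congrArg Complex.im h0
      simp at this
      norm_num at this
    · refine Filter.Eventually.of_forall fun t => ?_
      rw [htop]
      exact two_i_norm_bound _
  have hVtop : ∫ t : ℝ, (2 * Complex.I / (((t + (1:ℝ) * Complex.I : ℂ) - x
      + 2 * Complex.I) * ((t + (1:ℝ) * Complex.I : ℂ) - x))) = 0 := by
    simp_rw [htop]
    rw [integral_sub_right_eq_self (fun t : ℝ => 2 * Complex.I /
      (((t : ℝ) + 3 * Complex.I : ℂ) * ((t : ℝ) + Complex.I))) x, integral_top_zero]
  have hG1 : ∀ t : ℝ, G (t + (-1:ℝ) * Complex.I) = _ := fun t =>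
    hGne _ (sub_ne_zero.mp (hσne (-1) (by simp) t))
  have hG2 : ∀ t : ℝ, G (t + (1:ℝ) * Complex.I) = _ := fun t =>
    hGne _ (sub_ne_zero.mp (hσne 1 (by simp) t))
  have hs := shift_line (G := G) (c₁ := -1) (c₂ := 1) (x₀ := x)
    (B := B * ((N / π) ^ N * Real.exp π) + B * 2) (by norm_num)
    (hGd.mono fun w hw => by
      have := hw.1
      show -2 < w.im
      linarith) ?_ ?_ ?_
  · simp_rw [hG1, hG2] at hs
    rw [integral_sub (hkint _ (by simp)) (hIbot.const_mul _),
      integral_sub (hkint _ (by simp)) (hItop.const_mul _), integral_const_mul, integral_const_mul,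
      hVbot, hVtop] at hs
    linear_combination hs
  · simp_rw [hG1]
    exact (hkint _ (by simp)).sub (hIbot.const_mul _)
  · simp_rw [hG2]
    exact (hkint _ (by simp)).sub (hItop.const_mul _)
  · intro t s ht hs1 hs2
    have hs' : |s| ≤ 1 := abs_le.mpr ⟨hs1, hs2⟩
    set w : ℂ := t + s * Complex.I with hw
    have e1 : (w - x).im = s := by simp [hw]
    have e2 : (w - x).re = t - x := by simp [hw]
    have hwn : |t - x| ≤ ‖w - x‖ := by
      rw [← e2]; exact Complex.abs_re_le_norm _
    have hwn1 : 1 ≤ ‖w - x‖ := ht.trans hwn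
    have hne : w - x ≠ 0 := by
      rw [← norm_pos_iff]; linarith
    have hw2 : 1 ≤ ‖w - x + 2 * Complex.I‖ := by
      have := Complex.abs_re_le_norm (w - x + 2 * Complex.I)
      have e3 : (w - x + 2 * Complex.I).re = t - x := by simp [hw]
      rw [e3] at this
      exact ht.trans this
    have ht0 : 0 < |t - x| := by linarith
    rw [hGne w (sub_ne_zero.mp hne)]
    refine (norm_sub_le _ _).trans ?_
    rw [add_div]
    gcongr
    · rw [norm_mul, mul_div_assoc]
      gcongr
      · exact hB w (by simpa [hw] using hs')
      · refine (ker_bound hN hne).trans ?_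
        rw [e1]
        have : |t - x| ≤ ‖w - x‖ ^ (N + 1) :=
          hwn.trans (le_self_pow₀ hwn1 (by omega))
        gcongr
        nlinarith [Real.pi_pos]
    · rw [norm_mul, mul_div_assoc B]
      gcongr
      · exact hB x (by simp)
      · rw [norm_div, norm_mul, norm_mul, Complex.norm_I, mul_one, Complex.norm_ofNat]
        gcongr
        nlinarith

end CompLemma

namespace CompLemma

lemma rpow_enorm_add_le {p : ℝ} (hp : 0 < p) (hp1 : p < 1) (a b : ℂ) :
    ‖a + b‖ₑ ^ p ≤ ‖a‖ₑ ^ p + ‖b‖ₑ ^ p :=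
  (ENNReal.rpow_le_rpow (enorm_add_le a b) hp.le).trans
    (ENNReal.rpow_add_le_add_rpow _ _ hp.le hp1.le)

lemma line_rpow_measurable {f : ℂ → ℂ} (hf : DifferentiableOn ℂ f {z : ℂ | 0 < z.im}) {y : ℝ}
    (hy : 0 < y) (p : ℝ) : Measurable fun x : ℝ => ‖f (x + y * Complex.I)‖ₑ ^ p :=
  (f_line_cont hf hy).measurable.enorm.pow_const _

/-- The Hardy space of the upper half-plane, as a subspace of all functions. -/
def Up (p : ℝ) (hp : 0 < p) (hp1 : p < 1) : Submodule ℂ (ℂ → ℂ) where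
  carrier := {f | DifferentiableOn ℂ f {z : ℂ | 0 < z.im} ∧
    ∃ S : ℝ≥0∞, S < ⊤ ∧ ∀ y : ℝ, 0 < y → ∫⁻ x : ℝ, ‖f (x + y * Complex.I)‖ₑ ^ p ≤ S}
  add_mem' := by
    rintro f g ⟨hf, S, hS, h⟩ ⟨hg, T, hT, h'⟩
    refine ⟨hf.add hg, S + T, ENNReal.add_lt_top.mpr ⟨hS, hT⟩, fun y hy => ?_⟩
    calc _ ≤ ∫⁻ x : ℝ, (‖f (x + y * Complex.I)‖ₑ ^ p + ‖g (x + y * Complex.I)‖ₑ ^ p) :=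
          lintegral_mono fun x => rpow_enorm_add_le hp hp1 _ _
      _ = _ := lintegral_add_left (line_rpow_measurable hf hy p) _
      _ ≤ S + T := add_le_add (h y hy) (h' y hy)
  zero_mem' := by
    refine ⟨differentiableOn_const 0, 0, by simp, fun y hy => ?_⟩
    simp [hp]
  smul_mem' := by
    rintro c f ⟨hf, S, hS, h⟩
    refine ⟨hf.const_smul c, ‖c‖ₑ ^ p * S,
      ENNReal.mul_lt_top (ENNReal.rpow_lt_top_of_nonneg hp.le enorm_ne_top) hS, fun y hy => ?_⟩
    calc _ = ∫⁻ x : ℝ, ‖c‖ₑ ^ p * ‖f (x + y * Complex.I)‖ₑ ^ p := by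
          refine lintegral_congr fun x => ?_
          rw [Pi.smul_apply, smul_eq_mul, enorm_mul, ENNReal.mul_rpow_of_nonneg _ _ hp.le]
      _ = ‖c‖ₑ ^ p * ∫⁻ x : ℝ, ‖f (x + y * Complex.I)‖ₑ ^ p :=
          lintegral_const_mul _ (line_rpow_measurable hf hy p)
      _ ≤ _ := by gcongr; exact h y hy

lemma Up_bounded {p : ℝ} {hp : 0 < p} {hp1 : p < 1} {f : ℂ → ℂ} (hf : f ∈ Up p hp hp1) :
    ∃ B : ℝ, 0 ≤ B ∧ ∀ z : ℂ, 1 ≤ z.im → ‖f z‖ ≤ B := by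
  obtain ⟨h1, S, hS, h2⟩ := hf
  exact Hp_bounded hp h1 hS h2

lemma Up_integrable {p : ℝ} {hp : 0 < p} {hp1 : p < 1} {f : ℂ → ℂ} (hf : f ∈ Up p hp hp1)
    {N : ℕ} (hN : 1 ≤ N) (z : ℂ) : Integrable (lineF N f z (max 0 z.im + 1)) := by
  obtain ⟨B, hB0, hB⟩ := Up_bounded hf
  exact lineF_integrable hN hf.1 hB0 hB (by linarith [le_max_left 0 z.im])
    (by linarith [le_max_right 0 z.im])

/-- `Top` as a linear map on the Hardy space. -/
noncomputable def TopL (p : ℝ) (hp : 0 < p) (hp1 : p < 1) (N : ℕ) (hN : 1 ≤ N) :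
    Up p hp hp1 →ₗ[ℂ] (ℂ → ℂ) where
  toFun f := Top N f
  map_add' := by
    rintro ⟨f, hf⟩ ⟨g, hg⟩
    ext z
    show Top N (f + g) z = Top N f z + Top N g z
    unfold Top
    rw [← integral_add (Up_integrable hf hN z) (Up_integrable hg hN z)]
    refine integral_congr_ae (Filter.Eventually.of_forall fun t => ?_)
    simp only [lineF, Pi.add_apply]
    ring
  map_smul' := by
    rintro c ⟨f, hf⟩
    ext z
    show Top N (c • f) z = c * Top N f z
    unfold Top
    rw [← integral_const_mul]
    refine integral_congr_ae (Filter.Eventually.of_forall fun t => ?_)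
    simp only [lineF, Pi.smul_apply, smul_eq_mul]
    ring

/-- Reflection as a linear map. -/
noncomputable def negL : (ℂ → ℂ) →ₗ[ℂ] (ℂ → ℂ) := LinearMap.funLeft ℂ ℂ (fun w : ℂ => -w)

lemma negL_apply (g : ℂ → ℂ) (z : ℂ) : negL g z = g (-z) := rfl

/-- Pairs of Hardy functions. -/
noncomputable def V1 (p : ℝ) (hp : 0 < p) (hp1 : p < 1) : Submodule ℂ ((ℂ → ℂ) × (ℂ → ℂ)) :=
  (Up p hp hp1).prod ((Up p hp hp1).comap negL)

/-- The projection on pairs of Hardy functions. -/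
noncomputable def Q1 (p : ℝ) (hp : 0 < p) (hp1 : p < 1) (N : ℕ) (hN : 1 ≤ N) :
    V1 p hp hp1 →ₗ[ℂ] (ℂ → ℂ) :=
  (-(1 / (2 * π * Complex.I)) : ℂ) •
    ((TopL p hp hp1 N hN).comp
      (((LinearMap.fst ℂ (ℂ → ℂ) (ℂ → ℂ)).comp (V1 p hp hp1).subtype).codRestrict (Up p hp hp1)
        (fun x => x.2.1))
    + negL.comp ((TopL p hp hp1 N hN).comp
      ((negL.comp ((LinearMap.snd ℂ (ℂ → ℂ) (ℂ → ℂ)).comp (V1 p hp hp1).subtype)).codRestrict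
        (Up p hp hp1) (fun x => x.2.2))))

lemma Q1_apply (p : ℝ) (hp : 0 < p) (hp1 : p < 1) (N : ℕ) (hN : 1 ≤ N) (x : V1 p hp hp1) (z : ℂ) :
    Q1 p hp hp1 N hN x z =
      -(1 / (2 * π * Complex.I)) * (Top N x.1.1 z + Top N (negL x.1.2) (-z)) := rfl

/-- Entire functions. -/
def Ent : Submodule ℂ (ℂ → ℂ) where
  carrier := {h | Differentiable ℂ h}
  add_mem' := fun hf hg => Differentiable.add hf hg
  zero_mem' := differentiable_const 0
  smul_mem' := fun c _ hf => Differentiable.const_smul hf c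

/-- The embedding of entire functions. -/
noncomputable def J : Ent →ₗ[ℂ] ((ℂ → ℂ) × (ℂ → ℂ)) where
  toFun h := (fun z => Complex.exp ((Real.pi : ℂ) * Complex.I * z) * h.1 z,
           fun z => Complex.exp (-((Real.pi : ℂ) * Complex.I * z)) * h.1 z)
  map_add' := by
    rintro ⟨f, hf⟩ ⟨g, hg⟩
    ext z <;> simp <;> ring
  map_smul' := by
    rintro c ⟨f, hf⟩
    ext z <;> simp <;> ring

lemma J_injective : Function.Injective J := by
  rintro ⟨f, hf⟩ ⟨g, hg⟩ h
  ext z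
  have := congrFun (congrArg Prod.fst h) z
  exact mul_left_cancel₀ (Complex.exp_ne_zero _) this

/-- The inverse of `J`, as a partially defined map. -/
noncomputable def Q2 : ((ℂ → ℂ) × (ℂ → ℂ)) →ₗ.[ℂ] (ℂ → ℂ) where
  domain := LinearMap.range J
  toFun := Ent.subtype.comp (LinearEquiv.ofInjective J J_injective).symm.toLinearMap

lemma Q2_apply (h : Ent) (hx : J h ∈ Q2.domain) : Q2 ⟨J h, hx⟩ = h.1 := by
  show ((LinearEquiv.ofInjective J J_injective).symm ⟨J h, hx⟩).1 = h.1
  congr 1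
  rw [LinearEquiv.symm_apply_eq]
  rfl

lemma exp_line_norm (z : ℂ) : ‖Complex.exp (π * Complex.I * z)‖ = Real.exp (-(π * z.im)) := by
  rw [Complex.norm_exp]; simp

lemma lintegral_neg_line (F : ℝ → ℝ≥0∞) : ∫⁻ x : ℝ, F (-x) = ∫⁻ x : ℝ, F x := 
  lintegral_neg_eq_self F

lemma strip_bounded {p : ℝ} (hp : 0 < p) {h : ℂ → ℂ} (hh : Differentiable ℂ h) {S T : ℝ≥0∞}
    (hS : S < ⊤) (hT : T < ⊤)
    (h1 : ∀ y : ℝ, 0 < y →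
      ∫⁻ x : ℝ, ‖Complex.exp (π * Complex.I * (x + y * Complex.I)) * h (x + y * Complex.I)‖ₑ ^ p ≤ S)
    (h2 : ∀ y : ℝ, y < 0 →
      ∫⁻ x : ℝ, ‖Complex.exp (-(π * Complex.I * (x + y * Complex.I))) * h (x + y * Complex.I)‖ₑ ^ p
        ≤ T) :
    ∃ B : ℝ, ∀ z : ℂ, |z.im| ≤ 1 → ‖h z‖ ≤ B := by
  set E : ℝ≥0∞ := ENNReal.ofReal (Real.exp (2 * π)) ^ p with hE
  have hEt : E < ⊤ := ENNReal.rpow_lt_top_of_nonneg hp.le ENNReal.ofReal_ne_top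
  have hm : Measurable fun z : ℂ => ‖h z‖ₑ ^ p := hh.continuous.measurable.enorm.pow_const _
  have key : ∀ (z e : ℂ), Real.exp (-(2 * π)) ≤ ‖e‖ → ‖h z‖ₑ ^ p ≤ E * ‖e * h z‖ₑ ^ p := by
    intro z e he
    rw [hE, ← ENNReal.mul_rpow_of_nonneg _ _ hp.le]
    refine ENNReal.rpow_le_rpow ?_ hp.le
    rw [← ofReal_norm, ← ofReal_norm, ← ENNReal.ofReal_mul (by positivity), norm_mul]
    apply ENNReal.ofReal_le_ofReal
    have : 1 ≤ Real.exp (2 * π) * ‖e‖ := by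
      calc (1:ℝ) = Real.exp (2 * π) * Real.exp (-(2 * π)) := by rw [← Real.exp_add]; simp
        _ ≤ _ := by gcongr
    nlinarith [norm_nonneg (h z)]
  have hstrip := strip_lintegral hm (a := -2) (b := 2) (S := E * (S + T)) (by
    intro y hy1 hy2 hy0
    rcases lt_or_gt_of_ne hy0 with hy | hy
    · calc _ ≤ ∫⁻ x : ℝ, E * ‖Complex.exp (-(π * Complex.I * (x + y * Complex.I))) *
              h (x + y * Complex.I)‖ₑ ^ p := by
            refine lintegral_mono fun x => key _ _ ?_
            rw [Complex.norm_exp, Real.exp_le_exp]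
            simp
            nlinarith [Real.pi_pos]
        _ = E * _ := lintegral_const_mul' _ _ hEt.ne
        _ ≤ E * (S + T) := by gcongr; exact (h2 y hy).trans le_add_self
    · calc _ ≤ ∫⁻ x : ℝ, E * ‖Complex.exp (π * Complex.I * (x + y * Complex.I)) *
              h (x + y * Complex.I)‖ₑ ^ p := by
            refine lintegral_mono fun x => key _ _ ?_
            rw [Complex.norm_exp, Real.exp_le_exp]
            simp
            nlinarith [Real.pi_pos]
        _ = E * _ := lintegral_const_mul' _ _ hEt.ne
        _ ≤ E * (S + T) := by gcongr; exact (h1 y hy).trans le_self_add)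
  obtain ⟨B, -, hB⟩ := sup_bound hp isOpen_univ hh.differentiableOn
    (A := ENNReal.ofReal (2 - -2) * (E * (S + T)))
    (ENNReal.mul_lt_top ENNReal.ofReal_lt_top
      (ENNReal.mul_lt_top hEt (ENNReal.add_lt_top.mpr ⟨hS, hT⟩)))
  refine ⟨B, fun z hz => hB z (Set.subset_univ _) (le_trans (lintegral_mono_set ?_) hstrip)⟩
  intro w hw
  rw [Metric.mem_ball, dist_eq_norm] at hw
  have := (Complex.abs_im_le_norm (w - z)).trans_lt hw
  rw [Complex.sub_im, abs_lt] at this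
  rw [abs_le] at hz
  constructor <;> linarith [this.1, this.2, hz.1, hz.2]

lemma Top_entire {p : ℝ} {hp : 0 < p} {hp1 : p < 1} {f : ℂ → ℂ} (hf : f ∈ Up p hp hp1)
    {N : ℕ} (hN : 1 ≤ N) : Differentiable ℂ (Top N f) := by
  obtain ⟨B, hB0, hB⟩ := Up_bounded hf
  exact Top_differentiable hN hf.1 hB0 hB

lemma Q1_entire (p : ℝ) (hp : 0 < p) (hp1 : p < 1) (N : ℕ) (hN : 1 ≤ N) (x : V1 p hp hp1) :
    Differentiable ℂ (Q1 p hp hp1 N hN x) := by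
  have e : Q1 p hp hp1 N hN x = fun z =>
      -(1 / (2 * π * Complex.I)) * (Top N x.1.1 z + Top N (negL x.1.2) (-z)) := by
    ext z; exact Q1_apply ..
  rw [e]
  have h1 := Top_entire x.2.1 hN
  have h2 := Top_entire (p := p) (hp := hp) (hp1 := hp1) (f := negL x.1.2) x.2.2 hN
  exact (h1.add (h2.comp differentiable_neg)).const_mul _

lemma Q1_J (p : ℝ) (hp : 0 < p) (hp1 : p < 1) (N : ℕ) (hN : 1 ≤ N) (h : Ent)
    (hx : J h ∈ V1 p hp hp1) : Q1 p hp hp1 N hN ⟨J h, hx⟩ = h.1 := by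
  have hh : Differentiable ℂ h.1 := h.2
  obtain ⟨⟨-, S, hS, h1⟩, -, T, hT, h2⟩ := id hx
  obtain ⟨B, hB⟩ := strip_bounded hp hh hS hT h1 (by
    intro y hy
    refine le_trans (le_of_eq ?_) (h2 (-y) (by linarith))
    rw [← lintegral_neg_line]
    refine lintegral_congr fun x => ?_
    simp only [negL_apply, J, LinearMap.coe_mk, AddHom.coe_mk]
    have e : -((x:ℂ) + ((-y : ℝ):ℂ) * Complex.I) = ((-x : ℝ):ℂ) + (y:ℂ) * Complex.I := by
      push_cast; ring
    rw [e])
  have hreal : ∀ x : ℝ, Q1 p hp hp1 N hN ⟨J h, hx⟩ x = h.1 x := by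
    intro x
    rw [Q1_apply]
    have r := reproducing hN hh hB x
    have t1 : Top N (J h).1 x
        = ∫ t : ℝ, h.1 (t + (1 : ℝ) * Complex.I) * ker N (t + (1 : ℝ) * Complex.I - x) := by
      unfold Top
      have e0 : max 0 (x:ℂ).im + 1 = 1 := by simp
      rw [e0]
      refine integral_congr_ae (Filter.Eventually.of_forall fun t => ?_)
      simp only [lineF, J, LinearMap.coe_mk, AddHom.coe_mk]
      rw [Complex.exp_neg]
      field_simp [Complex.exp_ne_zero]
    have t2 : Top N (negL (J h).2) (-x)
        = - ∫ t : ℝ, h.1 (t + (-1 : ℝ) * Complex.I) * ker N (t + (-1 : ℝ) * Complex.I - x) := by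
      unfold Top
      have e0 : max 0 (-(x:ℂ)).im + 1 = 1 := by simp
      rw [e0, ← integral_neg_eq_self, ← integral_neg]
      refine integral_congr_ae (Filter.Eventually.of_forall fun t => ?_)
      simp only [lineF, J, LinearMap.coe_mk, AddHom.coe_mk, negL_apply]
      have e1 : ((-t : ℝ) : ℂ) + ((1:ℝ):ℂ) * Complex.I - -(x:ℂ)
          = -((t : ℂ) + ((-1:ℝ):ℂ) * Complex.I - x) := by push_cast; ring
      have e2 : -(((-t : ℝ) : ℂ) + ((1:ℝ):ℂ) * Complex.I)
          = (t : ℂ) + ((-1:ℝ):ℂ) * Complex.I := by push_cast; ring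
      have e3 : ((-t : ℝ) : ℂ) + ((1:ℝ):ℂ) * Complex.I
          = -((t : ℂ) + ((-1:ℝ):ℂ) * Complex.I) := by push_cast; ring
      rw [e1, ker_neg hN, e3, neg_neg, mul_neg]
      have e4 : Complex.exp (-(π * Complex.I * ((t : ℂ) + ((-1:ℝ):ℂ) * Complex.I))) *
          Complex.exp (-(π * Complex.I * -((t : ℂ) + ((-1:ℝ):ℂ) * Complex.I))) = 1 := by
        rw [← Complex.exp_add, ← Complex.exp_zero]
        congr 1
        ring
      linear_combination (-(h.1 (t + ((-1:ℝ):ℂ) * Complex.I) *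
        ker N (t + ((-1:ℝ):ℂ) * Complex.I - x))) * e4
    show -(1 / (2 * π * Complex.I)) * (Top N (J h).1 x + Top N (negL (J h).2) (-x)) = h.1 x
    rw [t1, t2]
    have hne : (2 * π * Complex.I : ℂ) ≠ 0 := by simp [Real.pi_ne_zero]
    have r' := r
    rw [sub_eq_iff_eq_add] at r'
    rw [r']
    field_simp
    ring
  have a1 : AnalyticOnNhd ℂ (Q1 p hp hp1 N hN ⟨J h, hx⟩) Set.univ :=
    (Q1_entire p hp hp1 N hN ⟨J h, hx⟩).differentiableOn.analyticOnNhd isOpen_univ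
  have a2 : AnalyticOnNhd ℂ h.1 Set.univ := hh.differentiableOn.analyticOnNhd isOpen_univ
  refine a1.eq_of_frequently_eq a2 (z₀ := 0) ?_
  have hs : Filter.Tendsto (fun n : ℕ => ((1 / ((n:ℝ) + 1) : ℝ) : ℂ)) Filter.atTop
      (nhdsWithin 0 {0}ᶜ) := by
    refine tendsto_nhdsWithin_iff.mpr ⟨?_, Filter.Eventually.of_forall fun n => ?_⟩
    · have := (Complex.continuous_ofReal.tendsto 0).comp
        (tendsto_one_div_add_atTop_nhds_zero_nat (𝕜 := ℝ))
      simpa [Function.comp_def] using this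
    · rw [Set.mem_compl_singleton_iff, Complex.ofReal_ne_zero]
      positivity
  exact hs.frequently (Filter.Frequently.of_forall fun n => hreal _)

end CompLemma

namespace CompLemma

lemma Top_type {p : ℝ} {hp : 0 < p} {hp1 : p < 1} {f : ℂ → ℂ} (hf : f ∈ Up p hp hp1)
    {N : ℕ} (hN : 1 ≤ N) : ∃ M : ℝ, 0 ≤ M ∧ ∀ z, ‖Top N f z‖ ≤ M * Real.exp (π * ‖z‖) := by
  obtain ⟨B, hB0, hB⟩ := Up_bounded hf
  exact ⟨_, by positivity, fun z => Top_bound hN hB0 hB z⟩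

lemma Q1_type (p : ℝ) (hp : 0 < p) (hp1 : p < 1) (N : ℕ) (hN : 1 ≤ N) (x : V1 p hp hp1) :
    ExpTypePi (Q1 p hp hp1 N hN x) := by
  refine ⟨Q1_entire p hp hp1 N hN x, fun ε hε => ?_⟩
  obtain ⟨M1, hM1, h1⟩ := Top_type x.2.1 hN
  obtain ⟨M2, hM2, h2⟩ := Top_type (p := p) (hp := hp) (hp1 := hp1) (f := negL x.1.2) x.2.2 hN
  refine ⟨‖(-(1 / (2 * π * Complex.I)) : ℂ)‖ * (M1 + M2) + 1, by positivity, fun z => ?_⟩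
  rw [Q1_apply, norm_mul]
  have h3 := h2 (-z)
  rw [norm_neg] at h3
  have h4 : ‖Top N x.1.1 z + Top N (negL x.1.2) (-z)‖ ≤ (M1 + M2) * Real.exp (π * ‖z‖) := by
    refine (norm_add_le _ _).trans ?_
    rw [add_mul]
    exact add_le_add (h1 z) h3
  have h5 : Real.exp (π * ‖z‖) ≤ Real.exp ((π + ε) * ‖z‖) := by
    rw [Real.exp_le_exp]
    nlinarith [norm_nonneg z]
  calc _ ≤ ‖(-(1 / (2 * π * Complex.I)) : ℂ)‖ * ((M1 + M2) * Real.exp (π * ‖z‖)) := by gcongr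
    _ ≤ ‖(-(1 / (2 * π * Complex.I)) : ℂ)‖ * ((M1 + M2) * Real.exp ((π + ε) * ‖z‖)) := by gcongr
    _ ≤ _ := by nlinarith [Real.exp_pos ((π + ε) * ‖z‖)]

/-- The constant in the norm estimate. -/
noncomputable def cst (p : ℝ) (N : ℕ) : ℝ≥0∞ :=
  ‖(-(1 / (2 * π * Complex.I)) : ℂ)‖ₑ ^ p *
    (ENNReal.ofReal ((N / π) ^ N * Real.exp (2 * π)) ^ p *
        ((ENNReal.ofReal (π * (1 / 2) ^ 2))⁻¹ * 3 * 2 + 1) * ENNReal.ofReal π)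

lemma cst_ne_top {p : ℝ} (hp : 0 < p) (N : ℕ) : cst p N ≠ ⊤ := by
  have hc : (ENNReal.ofReal (π * (1 / 2) ^ 2))⁻¹ ≠ ⊤ := by
    rw [ENNReal.inv_ne_top]
    simp
    positivity
  unfold cst
  refine ENNReal.mul_ne_top (ENNReal.rpow_ne_top_of_nonneg hp.le enorm_ne_top)
    (ENNReal.mul_ne_top (ENNReal.mul_ne_top
      (ENNReal.rpow_ne_top_of_nonneg hp.le ENNReal.ofReal_ne_top) ?_) ENNReal.ofReal_ne_top)
  exact ENNReal.add_ne_top.mpr ⟨ENNReal.mul_ne_top (ENNReal.mul_ne_top hc (by simp)) (by simp), by simp⟩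

lemma Q1_Lp (p : ℝ) (hp : 0 < p) (hp1 : p < 1) (N : ℕ) (hN : 1 ≤ N) (hNp : 1 / p ≤ (N + 1) / 2)
    (x : V1 p hp hp1) {S T : ℝ≥0∞}
    (h1 : ∀ y : ℝ, 0 < y → ∫⁻ t : ℝ, ‖x.1.1 (t + y * Complex.I)‖ₑ ^ p ≤ S)
    (h2 : ∀ y : ℝ, 0 < y → ∫⁻ t : ℝ, ‖negL x.1.2 (t + y * Complex.I)‖ₑ ^ p ≤ T) :
    ∫⁻ t : ℝ, ‖Q1 p hp hp1 N hN x t‖ₑ ^ p ≤ cst p N * (S + T) := by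
  have b1 := Top_Lp hp hp1 hN hNp x.2.1.1 h1
  have b2 := Top_Lp hp hp1 hN hNp (f := negL x.1.2) x.2.2.1 h2
  have hm : Measurable fun t : ℝ => ‖Top N x.1.1 t‖ₑ ^ p := by
    have := (Top_entire x.2.1 hN).continuous
    exact (this.comp Complex.continuous_ofReal).measurable.enorm.pow_const _
  calc _ ≤ ∫⁻ t : ℝ, ‖(-(1 / (2 * π * Complex.I)) : ℂ)‖ₑ ^ p *
        (‖Top N x.1.1 t‖ₑ ^ p + ‖Top N (negL x.1.2) ((-t : ℝ) : ℂ)‖ₑ ^ p) := by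
        refine lintegral_mono fun t => ?_
        rw [Q1_apply, enorm_mul, ENNReal.mul_rpow_of_nonneg _ _ hp.le, Complex.ofReal_neg]
        gcongr
        exact rpow_enorm_add_le hp hp1 _ _
    _ = ‖(-(1 / (2 * π * Complex.I)) : ℂ)‖ₑ ^ p * ((∫⁻ t : ℝ, ‖Top N x.1.1 t‖ₑ ^ p)
          + ∫⁻ t : ℝ, ‖Top N (negL x.1.2) (t : ℂ)‖ₑ ^ p) := by
        rw [lintegral_const_mul' _ _ (ENNReal.rpow_ne_top_of_nonneg hp.le enorm_ne_top),
          lintegral_add_left hm,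
          lintegral_neg_line (fun t : ℝ => ‖Top N (negL x.1.2) (t : ℂ)‖ₑ ^ p)]
    _ ≤ _ := mul_le_mul_right (add_le_add b1 b2) _
    _ = cst p N * (S + T) := by
        unfold cst
        ring

end CompLemma

open CompLemma

/-- **Complementation lemma.** For `0 < p < 1` there is a bounded linear map `Q`
from `Hᵖ(ℂ₊) ⊕ Hᵖ(ℂ₋)` to `Eᵖ` with `Q(h_π, h_{-π}) = h` for `h ∈ Eᵖ`, where
`h_{±π}(z) = e^{±iπz} h(z)`; hence the image of `Eᵖ` under `h ↦ (h_π, h_{-π})`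
is complemented in `Hᵖ(ℂ₊) ⊕ Hᵖ(ℂ₋)`. -/
theorem complementation_lemma (p : ℝ) (hp0 : 0 < p) (hp1 : p < 1) :
    ∃ (C : ℝ) (Q : ((ℂ → ℂ) × (ℂ → ℂ)) →ₗ[ℂ] (ℂ → ℂ)), 0 < C ∧
      (∀ f g : ℂ → ℂ,
        DifferentiableOn ℂ f {z : ℂ | 0 < z.im} →
        (⨆ (y : ℝ) (_ : 0 < y), ∫⁻ x : ℝ, (‖f (x + y * Complex.I)‖₊ : ℝ≥0∞) ^ p) < ⊤ →
        DifferentiableOn ℂ g {z : ℂ | z.im < 0} →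
        (⨆ (y : ℝ) (_ : y < 0), ∫⁻ x : ℝ, (‖g (x + y * Complex.I)‖₊ : ℝ≥0∞) ^ p) < ⊤ →
        ExpTypePi (Q (f, g)) ∧
        (∫⁻ x : ℝ, (‖Q (f, g) x‖₊ : ℝ≥0∞) ^ p) ≤
          ENNReal.ofReal C *
            ((⨆ (y : ℝ) (_ : 0 < y), ∫⁻ x : ℝ, (‖f (x + y * Complex.I)‖₊ : ℝ≥0∞) ^ p) +
             (⨆ (y : ℝ) (_ : y < 0), ∫⁻ x : ℝ, (‖g (x + y * Complex.I)‖₊ : ℝ≥0∞) ^ p))) ∧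
      (∀ h : ℂ → ℂ, ExpTypePi h →
        (∫⁻ x : ℝ, (‖h x‖₊ : ℝ≥0∞) ^ p) < ⊤ →
        Q (fun z => Complex.exp ((Real.pi : ℂ) * Complex.I * z) * h z,
           fun z => Complex.exp (-((Real.pi : ℂ) * Complex.I * z)) * h z) = h) := by
  obtain ⟨N, hN, hNp⟩ : ∃ N : ℕ, 1 ≤ N ∧ 1 / p ≤ ((N : ℝ) + 1) / 2 := by
    obtain ⟨n, hn⟩ := exists_nat_ge (2 * (1 / p))
    refine ⟨n + 1, by omega, ?_⟩
    push_cast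
    linarith
  let Q1' : ((ℂ → ℂ) × (ℂ → ℂ)) →ₗ.[ℂ] (ℂ → ℂ) := ⟨V1 p hp0 hp1, Q1 p hp0 hp1 N hN⟩
  have hcomp : ∀ (x : Q1'.domain) (y : Q2.domain),
      (x : (ℂ → ℂ) × (ℂ → ℂ)) = y → Q1' x = Q2 y := by
    rintro ⟨x, hx⟩ ⟨y, hy⟩ hxy
    obtain ⟨h, rfl⟩ := id hy
    obtain rfl : x = J h := hxy
    rw [Q2_apply]
    exact Q1_J p hp0 hp1 N hN h hx
  obtain ⟨Q, hQ⟩ := LinearMap.exists_extend (Q1'.sup Q2 hcomp).toFun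
  have hQ' : ∀ x : (Q1'.sup Q2 hcomp).domain, Q x = Q1'.sup Q2 hcomp x := fun x =>
    LinearMap.congr_fun hQ x
  have hQ1 : ∀ x : V1 p hp0 hp1, Q x = Q1 p hp0 hp1 N hN x := by
    intro x
    have hle := LinearPMap.left_le_sup Q1' Q2 hcomp
    exact (hQ' ⟨x, hle.1 x.2⟩).trans (hle.2 (x := x) (y := ⟨x, hle.1 x.2⟩) rfl).symm
  have hQ2 : ∀ h : Ent, Q (J h) = h.1 := by
    intro h
    have hle := LinearPMap.right_le_sup Q1' Q2 hcomp
    have hm : J h ∈ Q2.domain := ⟨h, rfl⟩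
    refine (hQ' ⟨J h, hle.1 hm⟩).trans
      ((hle.2 (x := ⟨J h, hm⟩) (y := ⟨J h, hle.1 hm⟩) rfl).symm.trans (Q2_apply h hm))
  refine ⟨(cst p N).toReal + 1, Q, by positivity, ?_, fun h hh _ => hQ2 ⟨h, hh.1⟩⟩
  intro f g hf hfS hg hgS
  set S := ⨆ (y : ℝ) (_ : 0 < y), ∫⁻ x : ℝ, (‖f (x + y * Complex.I)‖₊ : ℝ≥0∞) ^ p with hS
  set T := ⨆ (y : ℝ) (_ : y < 0), ∫⁻ x : ℝ, (‖g (x + y * Complex.I)‖₊ : ℝ≥0∞) ^ p with hT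
  have h1 : ∀ y : ℝ, 0 < y → ∫⁻ t : ℝ, ‖f (t + y * Complex.I)‖ₑ ^ p ≤ S := fun y hy =>
    le_iSup₂ (f := fun (y : ℝ) (_ : 0 < y) =>
      ∫⁻ x : ℝ, (‖f (x + y * Complex.I)‖₊ : ℝ≥0∞) ^ p) y hy
  have h2 : ∀ y : ℝ, 0 < y → ∫⁻ t : ℝ, ‖negL g (t + y * Complex.I)‖ₑ ^ p ≤ T := by
    intro y hy
    refine le_trans (le_of_eq ?_) (le_iSup₂ (f := fun (y : ℝ) (_ : y < 0) =>
      ∫⁻ x : ℝ, (‖g (x + y * Complex.I)‖₊ : ℝ≥0∞) ^ p) (-y) (by linarith))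
    rw [← lintegral_neg_line]
    refine lintegral_congr fun x => ?_
    have e : -(((-x : ℝ) : ℂ) + (y : ℂ) * Complex.I) = (x : ℂ) + ((-y : ℝ) : ℂ) * Complex.I := by
      push_cast; ring
    rw [negL_apply, e]
    rfl
  have hmem : (f, g) ∈ V1 p hp0 hp1 := by
    refine ⟨⟨hf, S, hfS, h1⟩, ?_, T, hgS, h2⟩
    refine hg.comp differentiable_neg.differentiableOn fun z hz => ?_
    have : 0 < z.im := hz
    show (-z).im < 0
    simpa using this
  have hq : Q (f, g) = Q1 p hp0 hp1 N hN ⟨(f, g), hmem⟩ := hQ1 ⟨(f, g), hmem⟩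
  rw [hq]
  refine ⟨Q1_type p hp0 hp1 N hN _, ?_⟩
  refine (Q1_Lp p hp0 hp1 N hN hNp ⟨(f, g), hmem⟩ h1 h2).trans ?_
  gcongr
  rw [ENNReal.le_ofReal_iff_toReal_le (cst_ne_top hp0 N) (by positivity)]
  linarith
end

section
/- Let 0 < p < 1. There is a constant C > 0 such that every f ∈ E^p satisfies ∫_ℂ e^{-π|Im z|} |Im z|^{1/p-2} |f(z)| dA(z) ≤ C ‖f‖_{E^p}, where dA denotes planar Lebesgue measure; that is, E^p embeds continuously into the space Z of entire functions with finite weighted integral ∫_ℂ e^{-π|Im z|} |Im z|^{1/p-2} |f(z)| dA(z). -/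
open MeasureTheory Real Complex
open scoped ENNReal NNReal

open Filter Topology in
/-- Sub-mean value property of `‖H‖ ^ α`, from the Jensen formula. -/
lemma submean {H : ℂ → ℂ} {r α : ℝ} (hr : 0 < r) (hα : 0 < α)
    (hH : AnalyticOnNhd ℂ H (Metric.closedBall 0 r)) :
    ‖H 0‖ ^ α ≤ Real.circleAverage (fun z => ‖H z‖ ^ α) 0 r := by
  have habs : |r| = r := abs_of_pos hr
  by_cases h0 : H 0 = 0
  · rw [h0, norm_zero, Real.zero_rpow hα.ne']
    apply Real.circleAverage_nonneg_of_nonneg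
    intro x _; positivity
  have hH' : AnalyticOnNhd ℂ H (Metric.closedBall 0 |r|) := by rwa [habs]
  have hHs : AnalyticOnNhd ℂ H (Metric.sphere 0 |r|) := hH'.mono Metric.sphere_subset_closedBall
  set m : ℝ := ‖H 0‖ ^ α with hm
  have hmpos : 0 < m := by positivity
  set L : ℂ → ℝ := fun z => Real.log ‖H z‖ with hL
  have hLint : CircleIntegrable L 0 r := hHs.meromorphicOn.circleIntegrable_log_norm
  have hJ : Real.log ‖H 0‖ ≤ Real.circleAverage L 0 r := by
    rw [hL, hH'.circleAverage_log_norm hr.ne' h0]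
    have : 0 ≤ ∑ᶠ u, (MeromorphicOn.divisor H (Metric.closedBall 0 |r|) u : ℝ)
        * Real.log (r * ‖0 - u‖⁻¹) := by
      apply finsum_nonneg
      intro u
      by_cases hu : u ∈ Metric.closedBall (0:ℂ) |r|
      · have h1 : (0:ℤ) ≤ MeromorphicOn.divisor H (Metric.closedBall 0 |r|) u := 
          MeromorphicOn.AnalyticOnNhd.divisor_nonneg hH' u
        have h2 : 0 ≤ Real.log (r * ‖0 - u‖⁻¹) := by
          by_cases hu0 : u = 0
          · simp [hu0]
          apply Real.log_nonneg
          rw [zero_sub, norm_neg, ← div_eq_mul_inv, one_le_div (by positivity)]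
          rw [habs] at hu
          simpa using hu
        exact mul_nonneg (by exact_mod_cast h1) h2
      · rw [Function.locallyFinsuppWithin.apply_eq_zero_of_notMem _ hu]
        simp
    linarith
  set F : ℂ → ℝ := fun z => m * (1 - Real.log m) + (m * α) * L z with hF
  have hFint : CircleIntegrable F 0 r := by
    apply CircleIntegrable.add
    · exact (continuousOn_const).circleIntegrable'
    · exact IntervalIntegrable.const_mul hLint _
  have hFavg : m ≤ Real.circleAverage F 0 r := by
    have h1 : Real.circleAverage F 0 r = m * (1 - Real.log m) + (m * α) * Real.circleAverage L 0 r := by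
      rw [hF, Real.circleAverage_fun_add]
      · rw [Real.circleAverage_const]
        congr 1
        exact Real.circleAverage_fun_smul (a := m * α) (f := L)
      · exact (continuousOn_const).circleIntegrable'
      · exact IntervalIntegrable.const_mul hLint _
    have h2 : Real.log m = α * Real.log ‖H 0‖ := by
      rw [hm, Real.log_rpow (by positivity)]
    rw [h1, h2]
    have : m * α * Real.log ‖H 0‖ ≤ m * α * Real.circleAverage L 0 r := by gcongr
    nlinarith
  set F' : ℂ → ℝ := fun z => if H z = 0 then 0 else F z with hF'
  have hcod : F =ᶠ[codiscreteWithin (Metric.sphere (0:ℂ) |r|)] F' := by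
    have : H ⁻¹' {0}ᶜ ∈ codiscreteWithin (Metric.closedBall (0:ℂ) |r|) := by
      apply hH'.preimage_zero_mem_codiscreteWithin h0
      · simp
      · exact (convex_closedBall _ _).isConnected ⟨0, by simp⟩
    have := codiscreteWithin_mono Metric.sphere_subset_closedBall this
    filter_upwards [this] with z hz
    have hz : H z ≠ 0 := hz
    simp [hF', hz]
  rw [Real.circleAverage_congr_codiscreteWithin hcod hr.ne'] at hFavg
  refine hFavg.trans ?_
  apply Real.circleAverage_mono (hFint.congr_codiscreteWithin hcod)
  · apply ContinuousOn.circleIntegrable'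
    intro z hz
    exact ((hHs z hz).continuousAt.norm.rpow_const (Or.inr hα.le)).continuousWithinAt
  · intro z _
    by_cases hz : H z = 0
    · simp [hF', hz, Real.zero_rpow hα.ne']
    · simp only [hF', hz, if_false, hF, hL]
      have ht : 0 < ‖H z‖ ^ α := by positivity
      have h1 := Real.log_le_sub_one_of_pos (div_pos ht hmpos)
      rw [Real.log_div ht.ne' hmpos.ne', Real.log_rpow (by positivity)] at h1
      have h2 := mul_le_mul_of_nonneg_left h1 hmpos.le
      have h3 : m * (‖H z‖ ^ α / m - 1) = ‖H z‖ ^ α - m := by field_simp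
      rw [h3] at h2
      linarith
/-- Cayley map. -/
noncomputable def cay (a b : ℝ) (w : ℂ) : ℂ := a * ((1 + w) / (1 - w)) + b * I

lemma cay_re (a b : ℝ) (w : ℂ) :
    (cay a b w).re = a * ((1 - ‖w‖ ^ 2) / ‖1 - w‖ ^ 2) := by
  have h1 : (cay a b w).re = a * ((1 + w) / (1 - w)).re := by
    simp [cay]
  rw [h1, Complex.div_re, ← Complex.normSq_eq_norm_sq, ← Complex.normSq_eq_norm_sq, ← add_div]
  congr 2
  simp [Complex.normSq_apply]
  ring

open Filter Topology in
lemma poisson {G : ℂ → ℂ} {B α a b : ℝ} (ha : 0 < a) (hα : 0 < α)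
    (hd : DifferentiableOn ℂ G {z | 0 < z.re}) (hc : ContinuousOn G {z | 0 ≤ z.re})
    (hB : ∀ z : ℂ, 0 ≤ z.re → ‖G z‖ ≤ B) :
    ENNReal.ofReal (‖G (a + b * I)‖ ^ α) ≤
      ∫⁻ t : ℝ, ENNReal.ofReal (π⁻¹ * a / (a ^ 2 + (t - b) ^ 2)) *
        ENNReal.ofReal (‖G (t * I)‖ ^ α) := by
  have hopen : IsOpen {z : ℂ | 0 < z.re} := isOpen_lt continuous_const Complex.continuous_re
  have hne : ∀ w : ℂ, ‖w‖ < 1 → 1 - w ≠ 0 := by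
    intro w hw h
    rw [sub_eq_zero] at h
    rw [← h] at hw; simp at hw
  have hpos : ∀ w : ℂ, ‖w‖ < 1 → 0 < (cay a b w).re := by
    intro w hw
    rw [cay_re]
    have := norm_pos_iff.2 (hne w hw)
    have h2 : 0 < 1 - ‖w‖ ^ 2 := by nlinarith [norm_nonneg w]
    positivity
  have hB0 : 0 ≤ B := (norm_nonneg _).trans (hB 0 (by simp))
  -- the function on the disc
  have hdiff : DifferentiableOn ℂ (fun w => G (cay a b w)) (Metric.ball 0 1) := by
    apply hd.comp (g := G) (f := cay a b)
    · unfold cay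
      intro w hw
      have := hne w (by simpa using hw)
      apply DifferentiableAt.differentiableWithinAt
      fun_prop (disch := assumption)
    · intro w hw
      exact hpos w (by simpa using hw)
  have hstep1 : ∀ r : ℝ, 0 < r → r < 1 → ‖G (a + b * I)‖ ^ α ≤
      (2 * π)⁻¹ * ∫ θ in (0:ℝ)..2 * π, ‖G (cay a b (circleMap 0 r θ))‖ ^ α := by
    intro r hr0 hr1
    have h := submean (H := fun w => G (cay a b w)) hr0 hα
      ((hdiff.analyticOnNhd Metric.isOpen_ball).mono (Metric.closedBall_subset_ball hr1))
    have h0 : cay a b 0 = a + b * I := by simp [cay]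
    simp only [h0] at h
    simpa [Real.circleAverage] using h
  have hcircne : ∀ θ ∈ Set.Ioo 0 (2 * π), (1 : ℂ) - circleMap 0 1 θ ≠ 0 := by
    intro θ hθ h
    rw [sub_eq_zero] at h
    have h2 : Complex.exp (θ * I) = 1 := by simpa [circleMap] using h.symm
    have h3 := (Complex.exp_eq_one_iff).1 h2
    obtain ⟨n, hn⟩ := h3
    have h4 : θ = n * (2 * π) := by
      have := congrArg Complex.im hn
      simpa using this
    have hpi := Real.pi_pos
    have h5 : (0:ℝ) < n := by
      by_contra hh
      push Not at hh
      have := hθ.1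
      nlinarith
    have h6 : (n:ℝ) < 1 := by
      by_contra hh
      push Not at hh
      have := hθ.2
      nlinarith
    have h7 : (0:ℤ) < n := by exact_mod_cast h5
    have h8 : n < (1:ℤ) := by exact_mod_cast h6
    omega
  have hmem1 : ∀ θ : ℝ, 0 ≤ (cay a b (circleMap 0 1 θ)).re := by
    intro θ; rw [cay_re]; simp
  have hlim : Tendsto (fun r : ℝ => ∫ θ in (0:ℝ)..2 * π, ‖G (cay a b (circleMap 0 r θ))‖ ^ α)
      (𝓝[<] 1) (𝓝 (∫ θ in (0:ℝ)..2 * π, ‖G (cay a b (circleMap 0 1 θ))‖ ^ α)) := by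
    apply intervalIntegral.tendsto_integral_filter_of_dominated_convergence (fun _ => B ^ α)
    · filter_upwards [Ioo_mem_nhdsLT (show (0:ℝ) < 1 by norm_num)] with r hr
      apply Continuous.aestronglyMeasurable
      apply Continuous.rpow_const _ (fun _ => Or.inr hα.le)
      apply Continuous.norm
      apply hdiff.continuousOn.comp_continuous (continuous_circleMap 0 r)
      intro θ
      simp [abs_of_pos hr.1, hr.2]
    · filter_upwards [Ioo_mem_nhdsLT (show (0:ℝ) < 1 by norm_num)] with r hr
      refine Eventually.of_forall fun θ _ => ?_
      rw [Real.norm_of_nonneg (by positivity)]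
      apply Real.rpow_le_rpow (norm_nonneg _) _ hα.le
      apply hB
      exact (hpos _ (by simp [abs_of_pos hr.1, hr.2])).le
    · simp
    · have hae : ∀ᵐ θ : ℝ, θ ≠ 2 * π := by
        simp [ae_iff]
      filter_upwards [hae] with θ hθ hθ'
      rw [Set.uIoc_of_le (by positivity)] at hθ'
      have hθ2 : θ ∈ Set.Ioo 0 (2 * π) := ⟨hθ'.1, lt_of_le_of_ne hθ'.2 hθ⟩
      apply Tendsto.rpow_const _ (Or.inr hα.le)
      apply Tendsto.norm
      have hcw := hc _ (hmem1 θ)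
      apply Tendsto.comp hcw
      apply tendsto_nhdsWithin_iff.2
      constructor
      · have hca : ContinuousAt (cay a b) (circleMap 0 1 θ) := by
          unfold cay
          have := hcircne θ hθ2
          fun_prop (disch := assumption)
        apply Tendsto.comp hca
        apply Tendsto.mono_left _ nhdsWithin_le_nhds
        apply Continuous.tendsto
        unfold circleMap
        fun_prop
      · filter_upwards [Ioo_mem_nhdsLT (show (0:ℝ) < 1 by norm_num)] with r hr
        exact (hpos _ (by simp [abs_of_pos hr.1, hr.2])).le
  have hstep2 : ‖G (a + b * I)‖ ^ α ≤
      (2 * π)⁻¹ * ∫ θ in (0:ℝ)..2 * π, ‖G (cay a b (circleMap 0 1 θ))‖ ^ α := by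
    apply ge_of_tendsto (hlim.const_mul _)
    filter_upwards [Ioo_mem_nhdsLT (show (0:ℝ) < 1 by norm_num)] with r hr
    exact hstep1 r hr.1 hr.2
  have hstep3 : ENNReal.ofReal (‖G (a + b * I)‖ ^ α) ≤ ENNReal.ofReal ((2 * π)⁻¹) *
      ∫⁻ θ in Set.Ioo 0 (2 * π), ENNReal.ofReal (‖G (cay a b (circleMap 0 1 θ))‖ ^ α) := by
    refine (ENNReal.ofReal_le_ofReal hstep2).trans ?_
    rw [ENNReal.ofReal_mul (by positivity)]
    gcongr
    rw [intervalIntegral.integral_of_le (by positivity), integral_Ioc_eq_integral_Ioo]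
    by_cases hi : IntegrableOn (fun θ => ‖G (cay a b (circleMap 0 1 θ))‖ ^ α) (Set.Ioo 0 (2 * π))
    · rw [ofReal_integral_eq_lintegral_ofReal hi]
      exact Eventually.of_forall fun θ => by positivity
    · rw [integral_undef hi]; simp
  refine hstep3.trans ?_
  -- change of variables
  set u : ℝ → ℝ := fun t => π - 2 * Real.arctan ((t - b) / a) with hu
  have himg : u '' Set.univ = Set.Ioo 0 (2 * π) := by
    ext θ
    simp only [Set.mem_image, Set.mem_univ, true_and, Set.mem_Ioo, hu]
    constructor
    · rintro ⟨t, rfl⟩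
      have h1 := Real.neg_pi_div_two_lt_arctan ((t - b) / a)
      have h2 := Real.arctan_lt_pi_div_two ((t - b) / a)
      constructor <;> linarith
    · rintro ⟨h1, h2⟩
      refine ⟨b + a * Real.tan ((π - θ) / 2), ?_⟩
      have : (b + a * Real.tan ((π - θ) / 2) - b) / a = Real.tan ((π - θ) / 2) := by
        field_simp; ring
      rw [this, Real.arctan_tan (by linarith) (by linarith)]
      ring
  have hinj : Set.InjOn u Set.univ := by
    intro s _ t _ hst
    simp only [hu] at hst
    have : Real.arctan ((s - b) / a) = Real.arctan ((t - b) / a) := by linarith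
    have := Real.arctan_injective this
    field_simp at this
    linarith
  have hder : ∀ t ∈ Set.univ, HasDerivWithinAt u (-(2 * (1 / (1 + ((t - b) / a) ^ 2) * (1 / a))))
      Set.univ t := by
    intro t _
    have h1 : HasDerivAt (fun t : ℝ => (t - b) / a) (1 / a) t :=
      ((hasDerivAt_id t).sub_const b).div_const a
    have h2 := (h1.arctan.const_mul 2).const_sub π
    exact h2.hasDerivWithinAt
  rw [← himg, lintegral_image_eq_lintegral_abs_deriv_mul MeasurableSet.univ hder hinj,
    Measure.restrict_univ, ← lintegral_const_mul' _ _ ENNReal.ofReal_ne_top]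
  apply le_of_eq
  congr 1
  ext t
  rw [← mul_assoc, ← ENNReal.ofReal_mul (by positivity)]
  congr 2
  · rw [abs_neg, abs_of_pos (by positivity)]
    field_simp
  · congr 3
    -- cay a b (circleMap 0 1 (u t)) = t * I
    set s : ℝ := (t - b) / a with hs
    have hcos : circleMap 0 1 (u t) = (s * I - 1) / (s * I + 1) := by
      have hz : (1:ℂ) + s * I ≠ 0 := by
        intro h
        have := congrArg Complex.re h
        simp at this
      have e1 : circleMap 0 1 (u t) = - Complex.exp (-(2 * Real.arctan s * I)) := by
        simp only [circleMap, hu, ← hs]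
        push_cast
        rw [zero_add, one_mul, sub_mul, sub_eq_add_neg, Complex.exp_add, Complex.exp_pi_mul_I]
        ring
      have e2 : Complex.exp (-(2 * Real.arctan s * I)) = Complex.exp (-(Real.arctan s) * I) ^ 2 := by
        rw [← Complex.exp_nat_mul]; congr 1; push_cast; ring
      have hsq : Real.sqrt (1 + s ^ 2) ^ 2 = 1 + s ^ 2 := Real.sq_sqrt (by positivity)
      have hsq' : ((Real.sqrt (1 + s ^ 2) : ℝ) : ℂ) ^ 2 = 1 + s ^ 2 := by exact_mod_cast hsq
      have hsq0 : ((Real.sqrt (1 + s ^ 2) : ℝ) : ℂ) ≠ 0 := by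
        have : 0 < Real.sqrt (1 + s ^ 2) := by positivity
        exact_mod_cast this.ne'
      have e3 : Complex.exp (-(Real.arctan s) * I) = (1 - s * I) / Real.sqrt (1 + s ^ 2) := by
        rw [← Complex.ofReal_neg, Complex.exp_mul_I, ← Complex.ofReal_cos, ← Complex.ofReal_sin,
          Real.cos_neg, Real.sin_neg, Real.cos_arctan, Real.sin_arctan]
        push_cast
        field_simp
        ring
      rw [e1, e2, e3, div_pow, hsq']
      have hf : (1:ℂ) + s ^ 2 = (1 + s * I) * (1 - s * I) := by
        ring_nf; rw [Complex.I_sq]; ring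
      have hz' : (1:ℂ) - s * I ≠ 0 := by
        intro h
        have := congrArg Complex.re h
        simp at this
      have hz2 : (s:ℂ) * I + 1 ≠ 0 := by rwa [add_comm]
      rw [hf]
      field_simp
      ring
    have hz2 : (s:ℂ) * I + 1 ≠ 0 := by
      intro h
      have := congrArg Complex.re h
      simp at this
    rw [hcos, cay]
    have hfin : ((1:ℂ) + (s * I - 1) / (s * I + 1)) / (1 - (s * I - 1) / (s * I + 1)) = s * I := by
      have e1 : (1:ℂ) + (s * I - 1) / (s * I + 1) = 2 * (s * I) / (s * I + 1) := by
        field_simp; ring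
      have e2 : (1:ℂ) - (s * I - 1) / (s * I + 1) = 2 / (s * I + 1) := by
        field_simp; ring
      rw [e1, e2]
      field_simp
    rw [hfin]
    have hsa : (a:ℂ) * s = t - b := by
      rw [hs]; push_cast
      have : (a:ℂ) ≠ 0 := by exact_mod_cast ha.ne'
      field_simp
    rw [← mul_assoc, hsa]
    ring
lemma lintegral_pois {a : ℝ} (ha : 0 < a) (b : ℝ) :
    ∫⁻ t : ℝ, ENNReal.ofReal (π⁻¹ * a / (a ^ 2 + (t - b) ^ 2)) = 1 := by
  lift a to ℝ≥0 using ha.le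
  have ha' : a ≠ 0 := by
    intro h; simp [h] at ha
  rw [← ProbabilityTheory.lintegral_cauchyPDF_eq_one b ha']
  congr 1
  ext t
  rw [ProbabilityTheory.cauchyPDF_def, ProbabilityTheory.cauchyPDFReal_def, div_eq_mul_inv,
    add_comm]

lemma nn_rpow (z : ℂ) {p : ℝ} (hp : 0 ≤ p) :
    (‖z‖₊ : ℝ≥0∞) ^ p = ENNReal.ofReal (‖z‖ ^ p) := by
  rw [← ENNReal.ofReal_rpow_of_nonneg (norm_nonneg z) hp, ofReal_norm]
  rfl

/-- Maps the right half plane to the first quadrant. -/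
noncomputable def zet (w : ℂ) : ℂ := Complex.exp ((π / 4 : ℝ) * I) * w ^ (((2:ℕ):ℂ)⁻¹)

lemma zet_sq {z : ℂ} (hz : 0 < z.re + z.im) : zet (-I * z ^ 2) = z := by
  set e : ℂ := Complex.exp ((π / 4 : ℝ) * I) with he
  set e' : ℂ := Complex.exp ((-(π / 4) : ℝ) * I) with he'
  have hee : e * e' = 1 := by
    rw [he, he', ← Complex.exp_add, ← Complex.exp_zero]; congr 1; push_cast; ring
  have he2 : e' ^ 2 = -I := by
    rw [he', ← Complex.exp_nat_mul]
    have : ((2:ℕ):ℂ) * ((-(π / 4) : ℝ) * I) = ((-(π / 2) : ℝ) : ℂ) * I := by push_cast; ring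
    rw [this, Complex.exp_mul_I, ← Complex.ofReal_cos, ← Complex.ofReal_sin]
    simp
  have hv : -I * z ^ 2 = (e' * z) ^ 2 := by rw [mul_pow, he2]
  have hre : 0 < (e' * z).re := by
    have : e' = ((Real.sqrt 2 / 2 : ℝ) : ℂ) - (Real.sqrt 2 / 2 : ℝ) * I := by
      rw [he', Complex.exp_mul_I, ← Complex.ofReal_cos, ← Complex.ofReal_sin, Real.cos_neg,
        Real.sin_neg, Real.cos_pi_div_four, Real.sin_pi_div_four]
      push_cast; ring
    rw [this]
    simp only [mul_re, sub_re, ofReal_re, I_re, mul_zero, ofReal_im, I_im, mul_one, sub_im,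
      mul_im, add_zero, zero_sub, sub_zero, sub_self]
    have h2 : 0 < Real.sqrt 2 := by positivity
    nlinarith
  have harg := abs_lt.1 (Complex.abs_arg_lt_pi_div_two_iff.2 (Or.inl hre))
  rw [zet, hv, Complex.pow_cpow_nat_inv two_ne_zero, ← mul_assoc, hee, one_mul]
  · push_cast; linarith [harg.1]
  · push_cast; linarith [harg.2]

lemma zet_norm (w : ℂ) : ‖zet w‖ = ‖w‖ ^ (2⁻¹ : ℝ) := by
  have h : (((2:ℕ):ℂ)⁻¹) = ((2⁻¹ : ℝ) : ℂ) := by push_cast; rfl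
  rw [zet, norm_mul, Complex.norm_exp_ofReal_mul_I, one_mul, h, Complex.norm_cpow_real]

lemma re_cpow34 {w : ℂ} (hw : 0 ≤ w.re) :
    Real.cos (3 * π / 8) * ‖w‖ ^ (3 / 4 : ℝ) ≤ (w ^ ((3 / 4 : ℝ) : ℂ)).re := by
  rw [Complex.cpow_ofReal_re, mul_comm]
  gcongr
  have h := Complex.abs_arg_le_pi_div_two_iff.2 hw
  rw [← Real.cos_abs (w.arg * (3/4))]
  apply Real.cos_le_cos_of_nonneg_of_le_pi (abs_nonneg _)
  · linarith [Real.pi_pos]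
  · rw [abs_mul, abs_of_pos (show (0:ℝ) < 3/4 by norm_num)]
    linarith

open Filter Topology in
lemma q1_bound {f : ℂ → ℂ} {p : ℝ} (hp : 0 < p) (hf : ExpTypePi f)
    (hI : (∫⁻ x : ℝ, (‖f x‖₊ : ℝ≥0∞) ^ p) < ⊤) :
    ∃ M : ℝ, ∀ x : ℝ, 1 ≤ x → ‖f (x + I)‖ ≤ M := by
  obtain ⟨hfd, hfe⟩ := hf
  obtain ⟨C, hC, hfC⟩ := hfe 1 one_pos
  set l : ℝ := π + 1 with hl
  have hlpos : 0 < l := by have := Real.pi_pos; positivity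
  set G : ℝ → ℂ → ℂ := fun δ w => f (zet w) * Complex.exp (I * l * zet w) *
    Complex.exp (-δ * w ^ ((3 / 4 : ℝ) : ℂ)) with hG
  have hGnorm : ∀ δ w, ‖G δ w‖ = ‖f (zet w)‖ * Real.exp (-l * (zet w).im) *
      Real.exp (-δ * (w ^ ((3 / 4 : ℝ) : ℂ)).re) := by
    intro δ w
    simp only [hG, norm_mul, Complex.norm_exp]
    congr 2
    · congr 1; simp
    · simp [-Complex.ofReal_div]
  set κ : ℝ := Real.cos (3 * π / 8) with hκ
  have hκpos : 0 < κ := Real.cos_pos_of_mem_Ioo ⟨by linarith [Real.pi_pos], by linarith [Real.pi_pos]⟩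
  have hzc : ∀ w : ℂ, 0 ≤ w.re → ContinuousAt zet w := by
    intro w hw
    unfold zet
    apply ContinuousAt.mul continuousAt_const
    apply Complex.continuousAt_cpow_const_of_re_pos (Or.inl hw)
    norm_num
  have hcont : ∀ δ, ContinuousOn (G δ) {z | 0 ≤ z.re} := by
    intro δ w hw
    apply ContinuousAt.continuousWithinAt
    have h1 := hzc w hw
    have h2 : ContinuousAt (fun w : ℂ => w ^ ((3 / 4 : ℝ) : ℂ)) w := by
      apply Complex.continuousAt_cpow_const_of_re_pos (Or.inl hw)
      rw [Complex.ofReal_re]; norm_num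
    have h3 : ContinuousAt (fun w => f (zet w)) w :=
      ContinuousAt.comp (hfd.continuous.continuousAt) h1
    simp only [hG]
    exact (h3.mul (continuousAt_const.mul h1).cexp).mul (continuousAt_const.mul h2).cexp
  have hdiff : ∀ δ, DifferentiableOn ℂ (G δ) {z | 0 < z.re} := by
    intro δ w hw
    apply DifferentiableAt.differentiableWithinAt
    have hs : w ∈ Complex.slitPlane := Or.inl hw
    have h1 : DifferentiableAt ℂ zet w := by
      unfold zet
      exact (differentiableAt_const _).mul (differentiableAt_id.cpow_const hs)
    have h2 : DifferentiableAt ℂ (fun w : ℂ => w ^ ((3 / 4 : ℝ) : ℂ)) w :=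
      differentiableAt_id.cpow_const hs
    have h3 : DifferentiableAt ℂ (fun w => f (zet w)) w :=
      DifferentiableAt.comp w (hfd _) h1
    simp only [hG]
    exact (h3.mul ((differentiableAt_const _).mul h1).cexp).mul
      ((differentiableAt_const _).mul h2).cexp
  have hbdd : ∀ δ > 0, ∃ B, ∀ z : ℂ, 0 ≤ z.re → ‖G δ z‖ ≤ B := by
    intro δ hδ
    refine ⟨C * Real.exp (2 * l * (2 * l / (δ * κ)) ^ 2), fun w hw => ?_⟩
    set s : ℝ := ‖w‖ ^ (4⁻¹ : ℝ) with hs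
    have hs0 : 0 ≤ s := by positivity
    have hs2 : ‖zet w‖ = s ^ 2 := by
      rw [zet_norm, hs, ← Real.rpow_natCast, ← Real.rpow_mul (norm_nonneg _)]; norm_num
    have hs3 : ‖w‖ ^ (3 / 4 : ℝ) = s ^ 3 := by
      rw [hs, ← Real.rpow_natCast, ← Real.rpow_mul (norm_nonneg _)]; norm_num
    have h34 := re_cpow34 hw
    rw [hs3] at h34
    have him : -(s ^ 2) ≤ (zet w).im := by
      rw [← hs2]
      exact (abs_le.1 (Complex.abs_im_le_norm (zet w))).1
    rw [hGnorm]
    calc _ ≤ (C * Real.exp (l * s ^ 2)) * Real.exp (l * s ^ 2) * Real.exp (-δ * (κ * s ^ 3)) := by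
          gcongr ?_ * Real.exp ?_ * Real.exp ?_
          · rw [← hs2]; exact hfC _
          · nlinarith
          · nlinarith
      _ = C * Real.exp (2 * l * s ^ 2 - δ * κ * s ^ 3) := by
          rw [mul_assoc, mul_assoc, ← Real.exp_add, ← Real.exp_add]; congr 2; ring
      _ ≤ _ := by
          gcongr
          have hdk : 0 < δ * κ := by positivity
          by_cases hsle : s ≤ 2 * l / (δ * κ)
          · have : 2 * l * s ^ 2 ≤ 2 * l * (2 * l / (δ * κ)) ^ 2 := by gcongr
            have : 0 ≤ δ * κ * s ^ 3 := by positivity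
            linarith
          · push Not at hsle
            rw [div_lt_iff₀ hdk] at hsle
            have h1 : 2 * l * s ^ 2 ≤ (s * (δ * κ)) * s ^ 2 := by gcongr
            have : 0 ≤ 2 * l * (2 * l / (δ * κ)) ^ 2 := by positivity
            nlinarith
  set J := ∫⁻ x : ℝ, (‖f x‖₊ : ℝ≥0∞) ^ p with hJ
  set K : ℝ≥0∞ := ENNReal.ofReal (C ^ p) + J with hK
  have hKtop : K ≠ ⊤ := by simp [hK, hI.ne]
  -- boundary values
  have hpos_t : ∀ δ > 0, ∀ t : ℝ, 0 ≤ t → ‖G δ (t * I)‖ ≤ C := by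
    intro δ hδ t ht
    have hre : 0 ≤ ((t * I : ℂ) ^ ((3 / 4 : ℝ) : ℂ)).re :=
      le_trans (by positivity) (re_cpow34 (w := t * I) (by simp))
    rw [hGnorm]
    have hz : zet (t * I) = Real.sqrt t * I := by
      rcases ht.eq_or_lt with h | h
      · rw [← h]; simp [zet]
      · have h1 : (t : ℂ) * I = -I * (Real.sqrt t * I) ^ 2 := by
          rw [mul_pow, Complex.I_sq, ← Complex.ofReal_pow, Real.sq_sqrt ht]; ring
        rw [h1]
        apply zet_sq
        simpa using h
    rw [hz]
    have h2 := hfC (Real.sqrt t * I)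
    have h3 : ‖(Real.sqrt t * I : ℂ)‖ = Real.sqrt t := by simp [abs_of_nonneg (Real.sqrt_nonneg t)]
    have h4 : (Real.sqrt t * I : ℂ).im = Real.sqrt t := by simp
    rw [h3] at h2
    rw [h4]
    calc _ ≤ (C * Real.exp (l * Real.sqrt t)) * Real.exp (-l * Real.sqrt t) * 1 := by
          gcongr
          rw [Real.exp_le_one_iff]; nlinarith
      _ = C := by rw [mul_one, mul_assoc, ← Real.exp_add]; simp
  have hneg_t : ∀ δ > 0, ∀ s : ℝ, 0 < s → ‖G δ (((-s ^ 2 : ℝ) : ℂ) * I)‖ ≤ ‖f s‖ := by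
    intro δ hδ s hs
    have hre : 0 ≤ ((((-s ^ 2 : ℝ) : ℂ) * I : ℂ) ^ ((3 / 4 : ℝ) : ℂ)).re :=
      le_trans (by positivity) (re_cpow34 (w := ((-s ^ 2 : ℝ) : ℂ) * I)
        (by rw [Complex.re_ofReal_mul]; simp))
    rw [hGnorm]
    have hz : zet (((-s ^ 2 : ℝ) : ℂ) * I) = s := by
      have h1 : ((-s ^ 2 : ℝ) : ℂ) * I = -I * (s:ℂ) ^ 2 := by push_cast; ring
      rw [h1]
      apply zet_sq
      simpa using hs
    rw [hz]
    simp only [Complex.ofReal_im, mul_zero, Real.exp_zero, mul_one]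
    apply mul_le_of_le_one_right (norm_nonneg _)
    rw [Real.exp_le_one_iff]; nlinarith
  have hmain : ∀ δ > 0, ∀ x : ℝ, 1 ≤ x →
      ENNReal.ofReal (‖G δ (((2 * x : ℝ) : ℂ) + ((1 - x ^ 2 : ℝ) : ℂ) * I)‖ ^ p) ≤ K := by
    intro δ hδ x hx
    obtain ⟨B, hB⟩ := hbdd δ hδ
    have h2x : 0 < 2 * x := by linarith
    refine (poisson (b := 1 - x ^ 2) h2x hp (hdiff δ) (hcont δ) hB).trans ?_
    rw [← lintegral_add_compl _ (measurableSet_Ici (a := (0:ℝ))), Set.compl_Ici]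
    apply add_le_add
    · calc _ ≤ ∫⁻ t in Set.Ici (0:ℝ), ENNReal.ofReal (π⁻¹ * (2 * x) / ((2 * x) ^ 2 + (t - (1 - x ^ 2)) ^ 2))
              * ENNReal.ofReal (C ^ p) := by
            apply setLIntegral_mono' measurableSet_Ici
            intro t ht
            gcongr
            exact hpos_t δ hδ t ht
        _ ≤ ∫⁻ t, ENNReal.ofReal (π⁻¹ * (2 * x) / ((2 * x) ^ 2 + (t - (1 - x ^ 2)) ^ 2))
              * ENNReal.ofReal (C ^ p) := setLIntegral_le_lintegral _ _
        _ = _ := by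
            rw [lintegral_mul_const' _ _ ENNReal.ofReal_ne_top, lintegral_pois h2x, one_mul]
    · have himg : (fun s : ℝ => -s ^ 2) '' Set.Ioi 0 = Set.Iio 0 := by
        ext t
        simp only [Set.mem_image, Set.mem_Ioi, Set.mem_Iio]
        constructor
        · rintro ⟨s, hs, rfl⟩
          have : 0 < s ^ 2 := by positivity
          linarith
        · intro ht
          refine ⟨Real.sqrt (-t), Real.sqrt_pos.2 (by linarith), ?_⟩
          rw [Real.sq_sqrt (by linarith)]; ring
      have hinj : Set.InjOn (fun s : ℝ => -s ^ 2) (Set.Ioi 0) := by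
        intro s hs t ht hst
        have hs : 0 < s := hs
        have ht : 0 < t := ht
        simp only [neg_inj] at hst
        exact (sq_eq_sq₀ hs.le ht.le).1 hst
      have hder : ∀ s ∈ Set.Ioi (0:ℝ), HasDerivWithinAt (fun s : ℝ => -s ^ 2) (-(2 * s))
          (Set.Ioi 0) s := by
        intro s _
        have : HasDerivAt (fun s : ℝ => -s ^ 2) (-(2 * s)) s := by
          simpa using (hasDerivAt_pow 2 s).fun_neg
        exact this.hasDerivWithinAt
      rw [← himg, lintegral_image_eq_lintegral_abs_deriv_mul measurableSet_Ioi hder hinj]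
      refine le_trans (setLIntegral_mono' (g := fun s : ℝ => (‖f s‖₊ : ℝ≥0∞) ^ p)
        measurableSet_Ioi ?_) (setLIntegral_le_lintegral _ _)
      intro s hs
      have hs : 0 < s := hs
      rw [← mul_assoc, ← ENNReal.ofReal_mul (abs_nonneg _), nn_rpow _ hp.le]
      have hA : ENNReal.ofReal (|-(2 * s)| * (π⁻¹ * (2 * x) / ((2 * x) ^ 2 + (-s ^ 2 - (1 - x ^ 2)) ^ 2))) ≤ 1 := by
        rw [ENNReal.ofReal_le_one, abs_neg, abs_of_pos (by positivity)]
        have hpi : π⁻¹ ≤ 1 := inv_le_one_of_one_le₀ (by linarith [Real.pi_gt_three])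
        rw [← mul_div_assoc, div_le_one (by positivity)]
        have e1 : (2 * x) ^ 2 + (-s ^ 2 - (1 - x ^ 2)) ^ 2 = ((s - x) ^ 2 + 1) * ((s + x) ^ 2 + 1) := by
          ring
        rw [e1]
        have e2 : 2 * s * (π⁻¹ * (2 * x)) ≤ 4 * s * x := by
          have : 0 < s * x := by positivity
          nlinarith
        nlinarith [sq_nonneg (s - x), sq_nonneg (s + x), mul_nonneg (sq_nonneg (s - x)) (sq_nonneg (s + x))]
      calc _ ≤ 1 * ENNReal.ofReal (‖f s‖ ^ p) := by
            gcongr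
            exact hneg_t δ hδ s hs
        _ = _ := one_mul _
  refine ⟨K.toReal ^ (p⁻¹) * Real.exp l, fun x hx => ?_⟩
  set w0 : ℂ := ((2 * x : ℝ) : ℂ) + ((1 - x ^ 2 : ℝ) : ℂ) * I with hw0
  have hzw : zet w0 = x + I := by
    have : w0 = -I * ((x:ℂ) + I) ^ 2 := by
      rw [hw0]; push_cast
      have h3 : I ^ 3 = -I := by rw [pow_succ, Complex.I_sq]; ring
      ring_nf
      rw [Complex.I_sq, h3]
      ring
    rw [this]
    apply zet_sq
    simp; linarith
  have hle : ∀ δ > 0, ‖G δ w0‖ ≤ K.toReal ^ (p⁻¹) := by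
    intro δ hδ
    have h1 := hmain δ hδ x hx
    have h2 : ‖G δ w0‖ ^ p ≤ K.toReal := by
      rw [← ENNReal.ofReal_le_ofReal_iff ENNReal.toReal_nonneg, ENNReal.ofReal_toReal hKtop]
      exact h1
    exact (Real.le_rpow_inv_iff_of_pos (norm_nonneg _) ENNReal.toReal_nonneg hp).2 h2
  have hlim : Tendsto (fun δ => ‖G δ w0‖) (𝓝[>] 0) (𝓝 (‖f (x + I)‖ * Real.exp (-l))) := by
    apply Tendsto.mono_left _ nhdsWithin_le_nhds
    apply Continuous.tendsto'
    · simp only [hGnorm]; fun_prop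
    · rw [hGnorm, hzw]; simp
  have := le_of_tendsto hlim (by filter_upwards [self_mem_nhdsWithin] with δ hδ using hle δ hδ)
  calc ‖f (x + I)‖ = ‖f (x + I)‖ * Real.exp (-l) * Real.exp l := by
        rw [mul_assoc, ← Real.exp_add]; simp
    _ ≤ _ := by gcongr
lemma ExpTypePi.comp_neg {f : ℂ → ℂ} (hf : ExpTypePi f) : ExpTypePi (fun z => f (-z)) := by
  refine ⟨hf.1.comp differentiable_neg, fun ε hε => ?_⟩
  obtain ⟨C, hC, h⟩ := hf.2 ε hε
  exact ⟨C, hC, fun z => by simpa using h (-z)⟩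

lemma ExpTypePi.conj {f : ℂ → ℂ} (hf : ExpTypePi f) :
    ExpTypePi (fun z => (starRingEnd ℂ) (f ((starRingEnd ℂ) z))) := by
  refine ⟨fun z => ?_, fun ε hε => ?_⟩
  · have := (hf.1 ((starRingEnd ℂ) z)).conj_conj
    simpa [Function.comp_def] using! this
  · obtain ⟨C, hC, h⟩ := hf.2 ε hε
    exact ⟨C, hC, fun z => by simpa using h ((starRingEnd ℂ) z)⟩

lemma lp_neg (f : ℂ → ℂ) (p : ℝ) :
    (∫⁻ x : ℝ, (‖f (-(x:ℂ))‖₊ : ℝ≥0∞) ^ p) = ∫⁻ x : ℝ, (‖f x‖₊ : ℝ≥0∞) ^ p := by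
  have := lintegral_neg_eq_self (μ := volume) (fun x : ℝ => (‖f x‖₊ : ℝ≥0∞) ^ p)
  simpa using this

lemma line_bound {f : ℂ → ℂ} {p : ℝ} (hp : 0 < p) (hf : ExpTypePi f)
    (hI : (∫⁻ x : ℝ, (‖f x‖₊ : ℝ≥0∞) ^ p) < ⊤) :
    ∃ M : ℝ, ∀ x : ℝ, ‖f (x - I)‖ ≤ M := by
  obtain ⟨M1, h1⟩ := q1_bound hp hf.comp_neg (by rw [lp_neg]; exact hI)
  obtain ⟨M2, h2⟩ := q1_bound hp hf.conj (by simpa using hI)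
  have hcont : Continuous (fun x : ℝ => f (x - I)) := hf.1.continuous.comp (by fun_prop)
  obtain ⟨M3, h3⟩ := (isCompact_Icc (a := (-1:ℝ)) (b := 1)).exists_bound_of_continuousOn
    hcont.continuousOn
  refine ⟨max M1 (max M2 M3), fun x => ?_⟩
  rcases le_total x (-1) with hx | hx
  · have := h1 (-x) (by linarith)
    have e : -(((-x : ℝ) : ℂ) + I) = x - I := by push_cast; ring
    rw [e] at this
    exact this.trans (le_max_left _ _)
  rcases le_total 1 x with hx' | hx'
  · have := h2 x hx'
    have e : (starRingEnd ℂ) ((x:ℂ) + I) = x - I := by simp [sub_eq_add_neg]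
    rw [e, Complex.norm_conj] at this
    exact this.trans ((le_max_left _ _).trans (le_max_right _ _))
  · exact (h3 x ⟨hx, hx'⟩).trans ((le_max_right _ _).trans (le_max_right _ _))

open Filter Topology Bornology in
lemma half_bound {f : ℂ → ℂ} {p : ℝ} (hp : 0 < p) (hf : ExpTypePi f)
    (hI : (∫⁻ x : ℝ, (‖f x‖₊ : ℝ≥0∞) ^ p) < ⊤) {ε : ℝ} (hε : 0 < ε) :
    ∃ B : ℝ, ∀ w : ℂ, 0 ≤ w.re → ‖f (I * w) * Complex.exp (-((π + ε : ℝ) : ℂ) * w)‖ ≤ B := by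
  obtain ⟨M, hM⟩ := line_bound hp hf hI
  obtain ⟨C, hC, hfC⟩ := hf.2 ε hε
  set l : ℝ := π + ε with hl
  have hlpos : 0 < l := by have := Real.pi_pos; positivity
  set F : ℂ → ℂ := fun w => f (I * w - I) * Complex.exp (-(l : ℂ) * w) with hF
  have hFn : ∀ w, ‖F w‖ = ‖f (I * w - I)‖ * Real.exp (-l * w.re) := by
    intro w
    simp [hF, Complex.norm_exp]
  have hnI : ∀ w : ℂ, ‖I * w - I‖ = ‖w - 1‖ := by
    intro w
    have : I * w - I = I * (w - 1) := by ring
    rw [this, norm_mul, Complex.norm_I, one_mul]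
  have hFd : Differentiable ℂ F := by
    have := hf.1
    have h2 : Differentiable ℂ (fun w : ℂ => I * w - I) := by fun_prop
    exact (this.comp h2).mul (by fun_prop)
  have hPL : ∀ w : ℂ, 0 ≤ w.re → ‖F w‖ ≤ M := by
    intro w hw
    apply PhragmenLindelof.right_half_plane_of_bounded_on_real hFd.diffContOnCl _ _ _ hw
    · refine ⟨1, by norm_num, 2 * l, ?_⟩
      apply Asymptotics.IsBigO.of_bound (C * Real.exp l)
      refine Eventually.of_forall fun z => ?_
      rw [hFn, Real.norm_of_nonneg (Real.exp_pos _).le, Real.rpow_one]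
      have h1 := hfC (I * z - I)
      rw [hnI] at h1
      have h2 : ‖z - 1‖ ≤ ‖z‖ + 1 := by simpa using norm_sub_le z 1
      have h3 : -z.re ≤ ‖z‖ := by
        have := (abs_le.1 (Complex.abs_re_le_norm z)).1
        linarith
      calc _ ≤ (C * Real.exp (l * (‖z‖ + 1))) * Real.exp (l * ‖z‖) := by
            gcongr ?_ * Real.exp ?_
            · exact h1.trans (by gcongr)
            · nlinarith
        _ = _ := by
            rw [mul_assoc, mul_assoc, ← Real.exp_add, ← Real.exp_add]; congr 2; ring
    · refine ⟨C * Real.exp l, ?_⟩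
      rw [eventually_map]
      filter_upwards [eventually_ge_atTop 1] with x hx
      rw [hFn]
      have h1 := hfC (I * x - I)
      rw [hnI] at h1
      have h2 : ‖(x:ℂ) - 1‖ = x - 1 := by
        rw [← Complex.ofReal_one, ← Complex.ofReal_sub, Complex.norm_real,
          Real.norm_of_nonneg (by linarith)]
      rw [h2] at h1
      rw [Complex.ofReal_re]
      calc _ ≤ (C * Real.exp (l * (x - 1))) * Real.exp (-l * x) := by
            gcongr
        _ = C * Real.exp (-l) := by
            rw [mul_assoc, ← Real.exp_add]; congr 2; ring
        _ ≤ _ := by gcongr; linarith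
    · intro x
      rw [hFn]
      have e : I * (x * I) - I = ((-x : ℝ) : ℂ) - I := by
        push_cast
        linear_combination (x:ℂ) * Complex.I_sq
      rw [e]
      simpa using hM (-x)
  refine ⟨M * Real.exp l, fun w hw => ?_⟩
  have h := hPL (w + 1) (by simp; linarith)
  have e : I * (w + 1) - I = I * w := by ring
  rw [hFn, e] at h
  rw [norm_mul, Complex.norm_exp]
  have e2 : (-(l:ℂ) * w).re = -l * w.re := by simp
  rw [e2]
  calc _ = ‖f (I * w)‖ * Real.exp (-l * (w + 1).re) * Real.exp l := by
        rw [mul_assoc, ← Real.exp_add]; congr 2; simp; ring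
    _ ≤ _ := by gcongr

open Filter Topology in
lemma pois_upper {f : ℂ → ℂ} {p α : ℝ} (hp : 0 < p) (hα : 0 < α) (hf : ExpTypePi f)
    (hI : (∫⁻ x : ℝ, (‖f x‖₊ : ℝ≥0∞) ^ p) < ⊤) {y : ℝ} (hy : 0 < y) (x : ℝ) :
    ENNReal.ofReal ((‖f (x + y * I)‖ * Real.exp (-π * y)) ^ α) ≤
      ∫⁻ t : ℝ, ENNReal.ofReal (π⁻¹ * y / (y ^ 2 + (x - t) ^ 2)) * (‖f t‖₊ : ℝ≥0∞) ^ α := by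
  have key : ∀ ε > 0, ENNReal.ofReal ((‖f (x + y * I)‖ * Real.exp (-(π + ε) * y)) ^ α) ≤
      ∫⁻ t : ℝ, ENNReal.ofReal (π⁻¹ * y / (y ^ 2 + (x - t) ^ 2)) * (‖f t‖₊ : ℝ≥0∞) ^ α := by
    intro ε hε
    obtain ⟨B, hB⟩ := half_bound hp hf hI hε
    have hd : Differentiable ℂ
        (fun w => f (I * w) * Complex.exp (-((π + ε : ℝ) : ℂ) * w)) := by
      have h2 : Differentiable ℂ (fun w : ℂ => I * w) := by fun_prop
      exact (hf.1.comp h2).mul (by fun_prop)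
    have h := poisson (b := -x) hy hα hd.differentiableOn hd.continuous.continuousOn hB
    rw [← lintegral_neg_eq_self] at h
    have e1 : I * ((y:ℂ) + ((-x : ℝ) : ℂ) * I) = x + y * I := by
      push_cast
      linear_combination (-(x:ℂ)) * Complex.I_sq
    have e2 : ‖Complex.exp (-((π + ε : ℝ) : ℂ) * ((y:ℂ) + ((-x : ℝ) : ℂ) * I))‖
        = Real.exp (-(π + ε) * y) := by
      rw [Complex.norm_exp]
      congr 1
      simp
    rw [e1, norm_mul, e2] at h
    refine h.trans (le_of_eq ?_)
    congr 1
    ext t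
    rw [nn_rpow _ hα.le]
    congr 2
    · congr 3; ring
    · congr 1
      have e3 : I * (((-t : ℝ) : ℂ) * I) = t := by
        push_cast
        linear_combination (-(t:ℂ)) * Complex.I_sq
      rw [e3, norm_mul, Complex.norm_exp]
      simp
  have hlim : Tendsto (fun ε : ℝ => ENNReal.ofReal ((‖f (x + y * I)‖ * Real.exp (-(π + ε) * y)) ^ α))
      (𝓝[>] 0) (𝓝 (ENNReal.ofReal ((‖f (x + y * I)‖ * Real.exp (-π * y)) ^ α))) := by
    apply Tendsto.mono_left _ nhdsWithin_le_nhds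
    apply Continuous.tendsto'
    · apply ENNReal.continuous_ofReal.comp
      apply Continuous.rpow_const _ (fun _ => Or.inr hα.le)
      fun_prop
    · simp
  exact le_of_tendsto hlim (by filter_upwards [self_mem_nhdsWithin] with δ hδ using key δ hδ)
/-- Poisson kernel. -/
noncomputable def PK (y s : ℝ) : ℝ≥0∞ := ENNReal.ofReal (π⁻¹ * y / (y ^ 2 + s ^ 2))

lemma PK_meas : Measurable (fun z : ℝ × ℝ => PK z.1 z.2) := by
  unfold PK; fun_prop

lemma PK_meas_sub (y : ℝ) : Measurable (fun z : ℝ × ℝ => PK y (z.1 - z.2)) := by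
  unfold PK; fun_prop

lemma PK_meas_t (y x : ℝ) : Measurable (fun t : ℝ => PK y (x - t)) := by
  unfold PK; fun_prop

lemma PK_meas_x (y t : ℝ) : Measurable (fun x : ℝ => PK y (x - t)) := by
  unfold PK; fun_prop

lemma PK_int_left {y : ℝ} (hy : 0 < y) (t : ℝ) : ∫⁻ x, PK y (x - t) = 1 :=
  lintegral_pois hy t

lemma PK_int_right {y : ℝ} (hy : 0 < y) (x : ℝ) : ∫⁻ t, PK y (x - t) = 1 := by
  rw [← lintegral_pois hy x]
  congr 1; ext t; unfold PK; congr 3; ring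

lemma PK_le {y : ℝ} (hy : 0 < y) (s : ℝ) : PK y s ≤ ENNReal.ofReal (y⁻¹) := by
  apply ENNReal.ofReal_le_ofReal
  have hpi : π⁻¹ ≤ 1 := inv_le_one_of_one_le₀ (by linarith [Real.pi_gt_three])
  have hpi0 : 0 < π⁻¹ := by positivity
  rw [div_le_iff₀ (by positivity)]
  have e : y⁻¹ * (y ^ 2 + s ^ 2) = y + y⁻¹ * s ^ 2 := by field_simp
  rw [e]
  have : 0 ≤ y⁻¹ * s ^ 2 := by positivity
  nlinarith

lemma PK_tonelli {y : ℝ} (hy : 0 < y) {φ : ℝ → ℝ≥0∞} (hφ : Measurable φ) :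
    ∫⁻ x, ∫⁻ t, PK y (x - t) * φ t = ∫⁻ t, φ t := by
  rw [lintegral_lintegral_swap]
  · congr 1; ext t
    rw [lintegral_mul_const, PK_int_left hy, one_mul]
    exact PK_meas_x y t
  · have h1 : Measurable (fun z : ℝ × ℝ => PK y (z.1 - z.2) * φ z.2) :=
      (PK_meas_sub y).mul (hφ.comp measurable_snd)
    exact h1.aemeasurable

lemma PK_jensen {y q : ℝ} (hy : 0 < y) (hq : 1 < q) {φ : ℝ → ℝ≥0∞} (hφ : Measurable φ) (x : ℝ) :
    (∫⁻ t, PK y (x - t) * φ t) ^ q ≤ ∫⁻ t, PK y (x - t) * φ t ^ q := by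
  have hm : Measurable (fun t : ℝ => PK y (x - t)) := PK_meas_t y x
  have hpq : (q.conjExponent).HolderConjugate q := (Real.HolderConjugate.conjExponent hq).symm
  set q' := q.conjExponent
  have hq0 : 0 < q := by linarith
  have hq'0 : 0 < q' := hpq.pos
  have h := ENNReal.lintegral_mul_le_Lp_mul_Lq volume hpq
    (f := fun t => PK y (x - t) ^ (1 / q')) (g := fun t => PK y (x - t) ^ (1 / q) * φ t)
    (hm.pow_const _).aemeasurable ((hm.pow_const _).mul hφ).aemeasurable
  have e1 : ∀ t, ((fun t => PK y (x - t) ^ (1 / q')) * (fun t => PK y (x - t) ^ (1 / q) * φ t)) t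
      = PK y (x - t) * φ t := by
    intro t
    simp only [Pi.mul_apply]
    rw [← mul_assoc, ← ENNReal.rpow_add_of_nonneg _ _ (by positivity) (by positivity),
      one_div, one_div, hpq.inv_add_inv_eq_one, ENNReal.rpow_one]
  have e2 : ∀ t, (PK y (x - t) ^ (1 / q')) ^ q' = PK y (x - t) := by
    intro t
    rw [← ENNReal.rpow_mul, one_div, inv_mul_cancel₀ hq'0.ne', ENNReal.rpow_one]
  have e3 : ∀ t, (PK y (x - t) ^ (1 / q) * φ t) ^ q = PK y (x - t) * φ t ^ q := by
    intro t
    rw [ENNReal.mul_rpow_of_nonneg _ _ hq0.le, ← ENNReal.rpow_mul, one_div,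
      inv_mul_cancel₀ hq0.ne', ENNReal.rpow_one]
  simp only [e1, e2, e3, PK_int_right hy, ENNReal.one_rpow, one_mul] at h
  calc _ ≤ ((∫⁻ t, PK y (x - t) * φ t ^ q) ^ (1 / q)) ^ q := by gcongr
    _ = _ := by rw [← ENNReal.rpow_mul, one_div, inv_mul_cancel₀ hq0.ne', ENNReal.rpow_one]

/-- small part -/
noncomputable def sm (v : ℝ → ℝ) (y t : ℝ) : ℝ≥0∞ :=
  if y * v t ^ 2 ≤ 1 then ENNReal.ofReal (v t) else 0
/-- big part -/
noncomputable def bg (v : ℝ → ℝ) (y t : ℝ) : ℝ≥0∞ :=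
  if y * v t ^ 2 ≤ 1 then 0 else ENNReal.ofReal (v t)

lemma sm_meas {v : ℝ → ℝ} (hv : Measurable v) : Measurable (fun z : ℝ × ℝ => sm v z.1 z.2) := by
  unfold sm
  refine Measurable.ite (measurableSet_le (by fun_prop) measurable_const) (by fun_prop)
    measurable_const

lemma bg_meas {v : ℝ → ℝ} (hv : Measurable v) : Measurable (fun z : ℝ × ℝ => bg v z.1 z.2) := by
  unfold bg
  refine Measurable.ite (measurableSet_le (by fun_prop) measurable_const) measurable_const
    (by fun_prop)

lemma sm_meas1 {v : ℝ → ℝ} (hv : Measurable v) (y : ℝ) : Measurable (fun t : ℝ => sm v y t) := by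
  unfold sm
  refine Measurable.ite (measurableSet_le (by fun_prop) measurable_const) (by fun_prop)
    measurable_const

lemma bg_meas1 {v : ℝ → ℝ} (hv : Measurable v) (y : ℝ) : Measurable (fun t : ℝ => bg v y t) := by
  unfold bg
  refine Measurable.ite (measurableSet_le (by fun_prop) measurable_const) measurable_const
    (by fun_prop)

lemma sm_add_bg (v : ℝ → ℝ) (y t : ℝ) : ENNReal.ofReal (v t) = sm v y t + bg v y t := by
  unfold sm bg; split_ifs <;> simp

lemma per_y {q : ℝ} (hq : 2 < q) {v : ℝ → ℝ} (hv : Measurable v) (hv0 : ∀ t, 0 ≤ v t)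
    (hI : ∫⁻ t, ENNReal.ofReal (v t ^ 2) ≤ 1) {y : ℝ} (hy : 0 < y) :
    ∫⁻ x, (∫⁻ t, PK y (x - t) * ENNReal.ofReal (v t)) ^ q ≤
      2 ^ (q - 1) * ((∫⁻ t, sm v y t ^ q) +
        ENNReal.ofReal (y ^ (-((q - 1) / 2))) * ∫⁻ t, bg v y t) := by
  have hs : Measurable (sm v y) := sm_meas1 hv y
  have hb : Measurable (bg v y) := bg_meas1 hv y
  have hbint : ∫⁻ t, bg v y t ≤ ENNReal.ofReal (y ^ (1 / 2 : ℝ)) := by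
    calc _ ≤ ∫⁻ t, ENNReal.ofReal (y ^ (1 / 2 : ℝ)) * ENNReal.ofReal (v t ^ 2) := by
          apply lintegral_mono
          intro t
          simp only [bg]
          split_ifs with h
          · simp
          · rw [← ENNReal.ofReal_mul (by positivity)]
            apply ENNReal.ofReal_le_ofReal
            push Not at h
            set r := y ^ (1 / 2 : ℝ) with hr
            have hr0 : 0 ≤ r := by positivity
            have hr2 : r ^ 2 = y := by
              rw [hr, ← Real.rpow_natCast, ← Real.rpow_mul hy.le]; norm_num
            have h1 : 1 < (r * v t) ^ 2 := by rw [mul_pow, hr2]; exact h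
            have h2 : 1 ≤ r * v t := by
              have := hv0 t
              by_contra hh
              push Not at hh
              have : 0 ≤ r * v t := by positivity
              nlinarith
            nlinarith [hv0 t]
      _ = ENNReal.ofReal (y ^ (1 / 2 : ℝ)) * ∫⁻ t, ENNReal.ofReal (v t ^ 2) :=
          lintegral_const_mul' _ _ ENNReal.ofReal_ne_top
      _ ≤ _ := by
          calc _ ≤ ENNReal.ofReal (y ^ (1 / 2 : ℝ)) * 1 := by gcongr
            _ = _ := mul_one _
  have hm : ∀ x, Measurable (fun t : ℝ => PK y (x - t)) := fun x => PK_meas_t y x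
  have hsup : ∀ x, ∫⁻ t, PK y (x - t) * bg v y t ≤ ENNReal.ofReal (y ^ (-(1 / 2) : ℝ)) := by
    intro x
    calc _ ≤ ∫⁻ t, ENNReal.ofReal (y⁻¹) * bg v y t := by
          apply lintegral_mono; intro t; dsimp only; gcongr; exact PK_le hy _
      _ = ENNReal.ofReal (y⁻¹) * ∫⁻ t, bg v y t := lintegral_const_mul' _ _ ENNReal.ofReal_ne_top
      _ ≤ ENNReal.ofReal (y⁻¹) * ENNReal.ofReal (y ^ (1 / 2 : ℝ)) := by gcongr
      _ = _ := by
          rw [← ENNReal.ofReal_mul (by positivity), ← Real.rpow_neg_one, ← Real.rpow_add hy]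
          norm_num
  have hpt : ∀ x, (∫⁻ t, PK y (x - t) * ENNReal.ofReal (v t)) ^ q ≤
      2 ^ (q - 1) * ((∫⁻ t, PK y (x - t) * sm v y t ^ q) +
        ENNReal.ofReal (y ^ (-((q - 1) / 2))) * ∫⁻ t, PK y (x - t) * bg v y t) := by
    intro x
    have e : ∫⁻ t, PK y (x - t) * ENNReal.ofReal (v t) =
        (∫⁻ t, PK y (x - t) * sm v y t) + ∫⁻ t, PK y (x - t) * bg v y t := by
      have hms : Measurable (fun t => PK y (x - t) * sm v y t) := (hm x).mul hs
      rw [← lintegral_add_left hms]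
      congr 1; ext t
      rw [sm_add_bg v y t, mul_add]
    rw [e]
    refine (ENNReal.rpow_add_le_mul_rpow_add_rpow _ _ (by linarith)).trans ?_
    gcongr
    · exact PK_jensen hy (by linarith) hs x
    · set Φ := ∫⁻ t, PK y (x - t) * bg v y t
      calc Φ ^ q = Φ ^ (q - 1) * Φ := by
            nth_rewrite 3 [← ENNReal.rpow_one Φ]
            rw [← ENNReal.rpow_add_of_nonneg _ _ (by linarith) (by norm_num)]
            congr 1; ring
        _ ≤ (ENNReal.ofReal (y ^ (-(1 / 2) : ℝ))) ^ (q - 1) * Φ := by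
            gcongr
            · linarith
            · exact hsup x
        _ = _ := by
            rw [ENNReal.ofReal_rpow_of_nonneg (by positivity) (by linarith), ← Real.rpow_mul hy.le]
            congr 3; ring
  refine (lintegral_mono hpt).trans ?_
  rw [lintegral_const_mul', lintegral_add_left', lintegral_const_mul' _ _ ENNReal.ofReal_ne_top,
    PK_tonelli hy hb, PK_tonelli hy (hs.pow_const q)]
  · have h2 : Measurable (fun z : ℝ × ℝ => PK y (z.1 - z.2) * sm v y z.2 ^ q) :=
      (PK_meas_sub y).mul ((hs.pow_const q).comp measurable_snd)
    exact (h2.lintegral_prod_right' (ν := volume)).aemeasurable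
  · exact ENNReal.rpow_ne_top_of_nonneg (by linarith) (by simp)

lemma small_int {q : ℝ} (hq : 2 < q) {v : ℝ → ℝ} (hv0 : ∀ t, 0 ≤ v t) (t : ℝ) :
    ∫⁻ y in Set.Ioi (0:ℝ), ENNReal.ofReal (y ^ (q / 2 - 2)) * sm v y t ^ q ≤
      ENNReal.ofReal (1 / (q / 2 - 1)) * ENNReal.ofReal (v t ^ 2) := by
  rcases (hv0 t).eq_or_lt with h | h
  · have : ∀ y, sm v y t ^ q = 0 := by
      intro y
      simp [sm, ← h]; linarith
    simp [this]
  set w := v t with hw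
  have hc : 0 < (w ^ 2)⁻¹ := by positivity
  have hsm : ∀ y ∈ Set.Ioi (0:ℝ), ENNReal.ofReal (y ^ (q / 2 - 2)) * sm v y t ^ q =
      (Set.Iic ((w ^ 2)⁻¹)).indicator
        (fun y => ENNReal.ofReal (y ^ (q / 2 - 2)) * ENNReal.ofReal (w ^ q)) y := by
    intro y hy
    simp only [sm, ← hw, Set.indicator, Set.mem_Iic]
    have : y * w ^ 2 ≤ 1 ↔ y ≤ (w ^ 2)⁻¹ := by
      rw [← one_div, le_div_iff₀ (by positivity)]
    simp only [this]
    split_ifs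
    · rw [ENNReal.ofReal_rpow_of_nonneg h.le (by linarith)]
    · rw [ENNReal.zero_rpow_of_pos (by linarith), mul_zero]
  rw [setLIntegral_congr_fun measurableSet_Ioi hsm, setLIntegral_indicator measurableSet_Iic,
    lintegral_mul_const' _ _ ENNReal.ofReal_ne_top, Set.inter_comm, Set.Ioi_inter_Iic]
  have hint : ∫⁻ y in Set.Ioc 0 ((w ^ 2)⁻¹), ENNReal.ofReal (y ^ (q / 2 - 2)) =
      ENNReal.ofReal (((w ^ 2)⁻¹) ^ (q / 2 - 1) / (q / 2 - 1)) := by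
    rw [← ofReal_integral_eq_lintegral_ofReal]
    · rw [← intervalIntegral.integral_of_le hc.le, integral_rpow (Or.inl (by linarith))]
      congr 1
      rw [Real.zero_rpow (by linarith)]
      have : q / 2 - 2 + 1 = q / 2 - 1 := by ring
      rw [this, sub_zero]
    · exact (intervalIntegrable_iff_integrableOn_Ioc_of_le hc.le).1
        (intervalIntegral.intervalIntegrable_rpow' (by linarith))
    · refine (ae_restrict_iff' measurableSet_Ioc).2 (Filter.Eventually.of_forall fun y hy => ?_)
      have := hy.1
      positivity
  have hq1 : 0 < q / 2 - 1 := by linarith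
  rw [hint, ← ENNReal.ofReal_mul (by positivity), ← ENNReal.ofReal_mul (by positivity)]
  apply ENNReal.ofReal_le_ofReal
  have e1 : ((w ^ 2)⁻¹) ^ (q / 2 - 1) * w ^ q = w ^ 2 := by
    rw [← Real.rpow_natCast, ← Real.rpow_neg h.le, ← Real.rpow_mul h.le, ← Real.rpow_add h]
    congr 1; push_cast; ring
  apply le_of_eq
  have e2 : ((w ^ 2)⁻¹) ^ (q / 2 - 1) / (q / 2 - 1) * w ^ q =
      1 / (q / 2 - 1) * (((w ^ 2)⁻¹) ^ (q / 2 - 1) * w ^ q) := by ring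
  rw [e2, e1]

lemma big_int {v : ℝ → ℝ} (hv0 : ∀ t, 0 ≤ v t) (t : ℝ) :
    ∫⁻ y in Set.Ioi (0:ℝ), ENNReal.ofReal (y ^ (-(3 / 2) : ℝ)) * bg v y t ≤
      2 * ENNReal.ofReal (v t ^ 2) := by
  rcases (hv0 t).eq_or_lt with h | h
  · have : ∀ y, bg v y t = 0 := by
      intro y
      simp [bg, ← h]
    simp [this]
  set w := v t with hw
  have hc : 0 < (w ^ 2)⁻¹ := by positivity
  have hbg : ∀ y ∈ Set.Ioi (0:ℝ), ENNReal.ofReal (y ^ (-(3 / 2) : ℝ)) * bg v y t =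
      (Set.Ioi ((w ^ 2)⁻¹)).indicator
        (fun y => ENNReal.ofReal (y ^ (-(3 / 2) : ℝ)) * ENNReal.ofReal w) y := by
    intro y hy
    simp only [bg, ← hw, Set.indicator, Set.mem_Ioi]
    have : y * w ^ 2 ≤ 1 ↔ ¬ ((w ^ 2)⁻¹ < y) := by
      rw [← one_div, not_lt, le_div_iff₀ (by positivity)]
    simp only [this]
    split_ifs <;> simp_all
  rw [setLIntegral_congr_fun measurableSet_Ioi hbg, setLIntegral_indicator measurableSet_Ioi,
    lintegral_mul_const' _ _ ENNReal.ofReal_ne_top]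
  have hint : ∫⁻ y in Set.Ioi ((w ^ 2)⁻¹), ENNReal.ofReal (y ^ (-(3 / 2) : ℝ)) =
      ENNReal.ofReal (2 * w) := by
    rw [← ofReal_integral_eq_lintegral_ofReal]
    · rw [integral_Ioi_rpow_of_lt (by norm_num) hc]
      congr 1
      have e1 : ((w ^ 2)⁻¹) ^ (-(3 / 2) + 1 : ℝ) = w := by
        rw [← Real.rpow_natCast, ← Real.rpow_neg h.le, ← Real.rpow_mul h.le]
        norm_num
      rw [e1]; ring
    · exact integrableOn_Ioi_rpow_of_lt (by norm_num) hc
    · refine (ae_restrict_iff' measurableSet_Ioi).2 (Filter.Eventually.of_forall fun y hy => ?_)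
      have : 0 < y := hc.trans hy
      positivity
  have hsub : Set.Ioi ((w ^ 2)⁻¹) ∩ Set.Ioi 0 = Set.Ioi ((w ^ 2)⁻¹) :=
    Set.inter_eq_left.2 (Set.Ioi_subset_Ioi hc.le)
  rw [hsub, hint, ← ENNReal.ofReal_mul (by positivity)]
  have : (2:ℝ≥0∞) = ENNReal.ofReal 2 := by simp
  rw [this, ← ENNReal.ofReal_mul (by norm_num)]
  apply le_of_eq; congr 1; ring

lemma HL {q : ℝ} (hq : 2 < q) {v : ℝ → ℝ} (hv : Measurable v) (hv0 : ∀ t, 0 ≤ v t)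
    (hI : ∫⁻ t, ENNReal.ofReal (v t ^ 2) ≤ 1) :
    ∫⁻ y in Set.Ioi (0:ℝ), ENNReal.ofReal (y ^ (q / 2 - 2)) *
      ∫⁻ x, (∫⁻ t, PK y (x - t) * ENNReal.ofReal (v t)) ^ q ≤
      2 ^ (q - 1) * (ENNReal.ofReal (1 / (q / 2 - 1)) + 2) := by
  have hS : Measurable (fun z : ℝ × ℝ => ENNReal.ofReal (z.1 ^ (q / 2 - 2)) * sm v z.1 z.2 ^ q) :=
    Measurable.mul (by fun_prop) ((sm_meas hv).pow_const q)
  have hBm : Measurable (fun z : ℝ × ℝ => ENNReal.ofReal (z.1 ^ (-(3 / 2) : ℝ)) * bg v z.1 z.2) :=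
    Measurable.mul (by fun_prop) (bg_meas hv)
  calc _ ≤ ∫⁻ y in Set.Ioi (0:ℝ), 2 ^ (q - 1) *
        ((∫⁻ t, ENNReal.ofReal (y ^ (q / 2 - 2)) * sm v y t ^ q) +
          ∫⁻ t, ENNReal.ofReal (y ^ (-(3 / 2) : ℝ)) * bg v y t) := by
        apply setLIntegral_mono' measurableSet_Ioi
        intro y hy
        have hy : 0 < y := hy
        calc _ ≤ ENNReal.ofReal (y ^ (q / 2 - 2)) * (2 ^ (q - 1) * ((∫⁻ t, sm v y t ^ q) +
              ENNReal.ofReal (y ^ (-((q - 1) / 2))) * ∫⁻ t, bg v y t)) := by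
              gcongr
              exact per_y hq hv hv0 hI hy
          _ = _ := by
              rw [lintegral_const_mul' _ _ ENNReal.ofReal_ne_top,
                lintegral_const_mul' _ _ ENNReal.ofReal_ne_top, mul_left_comm, mul_add,
                ← mul_assoc (ENNReal.ofReal (y ^ (q / 2 - 2))) (ENNReal.ofReal _),
                ← ENNReal.ofReal_mul (by positivity), ← Real.rpow_add hy]
              congr 5
              ring
    _ = 2 ^ (q - 1) * ((∫⁻ y in Set.Ioi (0:ℝ), ∫⁻ t, ENNReal.ofReal (y ^ (q / 2 - 2)) * sm v y t ^ q) +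
          ∫⁻ y in Set.Ioi (0:ℝ), ∫⁻ t, ENNReal.ofReal (y ^ (-(3 / 2) : ℝ)) * bg v y t) := by
        rw [lintegral_const_mul', lintegral_add_left']
        · exact (hS.lintegral_prod_right (ν := volume)).aemeasurable
        · exact ENNReal.rpow_ne_top_of_nonneg (by linarith) (by simp)
    _ ≤ 2 ^ (q - 1) * (ENNReal.ofReal (1 / (q / 2 - 1)) * 1 + 2 * 1) := by
        gcongr
        · rw [lintegral_lintegral_swap hS.aemeasurable]
          refine (lintegral_mono (small_int hq hv0)).trans ?_
          rw [lintegral_const_mul' _ _ ENNReal.ofReal_ne_top]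
          gcongr
        · rw [lintegral_lintegral_swap hBm.aemeasurable]
          refine (lintegral_mono (big_int hv0)).trans ?_
          rw [lintegral_const_mul' _ _ (by simp)]
          gcongr
    _ = _ := by simp

lemma upper_A {p : ℝ} (hp0 : 0 < p) (hp1 : p < 1) {f : ℂ → ℂ} (hf : ExpTypePi f)
    (hI : (∫⁻ x : ℝ, (‖f x‖₊ : ℝ≥0∞) ^ p) < ⊤) {A : ℝ} (hA : 0 < A)
    (hJA : (∫⁻ x : ℝ, (‖f x‖₊ : ℝ≥0∞) ^ p) ≤ ENNReal.ofReal A) :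
    ∫⁻ y in Set.Ioi (0:ℝ), ∫⁻ x : ℝ, ENNReal.ofReal
            (Real.exp (-Real.pi * |y|) * |y| ^ (1 / p - 2)) * (‖f (x + y * I)‖₊ : ℝ≥0∞) ≤
      2 ^ (2 / p - 1) * (ENNReal.ofReal (1 / (2 / p / 2 - 1)) + 2) * ENNReal.ofReal A ^ (1 / p) := by
  have hq : 2 < 2 / p := by rw [lt_div_iff₀ hp0]; linarith
  set q := 2 / p with hqdef
  have hpq : p / 2 * q = 1 := by rw [hqdef]; field_simp
  have hq2 : q / 2 = 1 / p := by rw [hqdef]; field_simp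
  have hcont : Continuous (fun t : ℝ => f t) := hf.1.continuous.comp continuous_ofReal
  have hfm : Measurable (fun t : ℝ => ‖f t‖ ^ (p / 2)) := by
    exact hcont.norm.measurable.pow_const (p / 2)
  let v : ℝ → ℝ := fun t => ‖f t‖ ^ (p / 2) / √A
  have hv : Measurable v := hfm.div_const _
  have hv0 : ∀ t, 0 ≤ v t := fun t => by positivity
  have hsA : 0 < √A := Real.sqrt_pos.2 hA
  have hvI : ∫⁻ t, ENNReal.ofReal (v t ^ 2) ≤ 1 := by
    have e : ∀ t : ℝ, ENNReal.ofReal (v t ^ 2) = ENNReal.ofReal (A⁻¹) * (‖f t‖₊ : ℝ≥0∞) ^ p := by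
      intro t
      rw [nn_rpow _ hp0.le, ← ENNReal.ofReal_mul (by positivity)]
      congr 1
      simp only [v]
      rw [div_pow, Real.sq_sqrt hA.le, ← Real.rpow_natCast, ← Real.rpow_mul (norm_nonneg _)]
      have : p / 2 * ((2:ℕ):ℝ) = p := by push_cast; ring
      rw [this]; ring
    simp_rw [e]
    rw [lintegral_const_mul' _ _ ENNReal.ofReal_ne_top]
    calc _ ≤ ENNReal.ofReal (A⁻¹) * ENNReal.ofReal A := by gcongr
      _ = 1 := by
        rw [← ENNReal.ofReal_mul (by positivity), inv_mul_cancel₀ hA.ne', ENNReal.ofReal_one]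
  have hfv : ∀ t : ℝ, (‖f t‖₊ : ℝ≥0∞) ^ (p / 2) = ENNReal.ofReal (√A) * ENNReal.ofReal (v t) := by
    intro t
    rw [nn_rpow _ (by positivity), ← ENNReal.ofReal_mul (by positivity)]
    congr 1
    simp only [v]
    field_simp
  have hpt : ∀ y ∈ Set.Ioi (0:ℝ), (∫⁻ x : ℝ, ENNReal.ofReal
            (Real.exp (-Real.pi * |y|) * |y| ^ (1 / p - 2)) * (‖f (x + y * I)‖₊ : ℝ≥0∞)) ≤
      ENNReal.ofReal A ^ (1 / p) * (ENNReal.ofReal (y ^ (q / 2 - 2)) *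
        ∫⁻ x, (∫⁻ t, PK y (x - t) * ENNReal.ofReal (v t)) ^ q) := by
    intro y hy
    have hy : 0 < y := hy
    have hAt : ENNReal.ofReal A ^ (1 / p) ≠ ⊤ :=
      ENNReal.rpow_ne_top_of_nonneg (by positivity) ENNReal.ofReal_ne_top
    rw [← lintegral_const_mul' _ _ ENNReal.ofReal_ne_top, ← lintegral_const_mul' _ _ hAt]
    apply lintegral_mono
    intro x
    dsimp only
    have h1 := pois_upper hp0 (half_pos hp0) hf hI hy x
    have h2 : ∫⁻ t:ℝ, ENNReal.ofReal (π⁻¹*y/(y^2+(x-t)^2)) * (‖f t‖₊:ℝ≥0∞)^(p/2) =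
        ENNReal.ofReal (√A) * ∫⁻ t, PK y (x - t) * ENNReal.ofReal (v t) := by
      rw [← lintegral_const_mul' _ _ ENNReal.ofReal_ne_top]
      congr 1; ext t
      rw [hfv t, mul_left_comm]; rfl
    rw [h2] at h1
    have h3 := ENNReal.rpow_le_rpow h1 (by linarith : 0 ≤ q)
    rw [ENNReal.ofReal_rpow_of_nonneg (by positivity) (by linarith), ← Real.rpow_mul (by positivity),
      hpq, Real.rpow_one, ENNReal.mul_rpow_of_nonneg _ _ (by linarith)] at h3
    have h4 : ENNReal.ofReal (√A) ^ q = ENNReal.ofReal A ^ (1 / p) := by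
      rw [ENNReal.ofReal_rpow_of_nonneg hsA.le (by linarith),
        ENNReal.ofReal_rpow_of_nonneg hA.le (by positivity), Real.sqrt_eq_rpow,
        ← Real.rpow_mul hA.le, ← hq2]
      congr 2; ring
    rw [h4] at h3
    calc _ = ENNReal.ofReal (y ^ (q / 2 - 2)) *
          ENNReal.ofReal (‖f (x + y * I)‖ * Real.exp (-π * y)) := by
          have e5 : (‖f (x + y * I)‖₊ : ℝ≥0∞) = ENNReal.ofReal ‖f (x + y * I)‖ := by
            rw [ofReal_norm]; rfl
          rw [e5, ← ENNReal.ofReal_mul (by positivity), ← ENNReal.ofReal_mul (by positivity),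
            abs_of_pos hy, hq2]
          congr 1; ring
      _ ≤ ENNReal.ofReal (y ^ (q / 2 - 2)) * (ENNReal.ofReal A ^ (1 / p) *
          (∫⁻ t, PK y (x - t) * ENNReal.ofReal (v t)) ^ q) := by gcongr
      _ = _ := by rw [mul_left_comm]
  refine (setLIntegral_mono' measurableSet_Ioi hpt).trans ?_
  have hAt : ENNReal.ofReal A ^ (1 / p) ≠ ⊤ :=
      ENNReal.rpow_ne_top_of_nonneg (by positivity) ENNReal.ofReal_ne_top
  rw [lintegral_const_mul' _ _ hAt, mul_comm]
  gcongr
  exact HL hq hv hv0 hvI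

/-- The constant for one half-plane. -/
noncomputable def KK (p : ℝ) : ℝ≥0∞ :=
  2 ^ (2 / p - 1) * (ENNReal.ofReal (1 / (2 / p / 2 - 1)) + 2)

lemma KK_ne_top {p : ℝ} (hp0 : 0 < p) (hp1 : p < 1) : KK p ≠ ⊤ := by
  have hq : 2 < 2 / p := by rw [lt_div_iff₀ hp0]; linarith
  exact ENNReal.mul_ne_top (ENNReal.rpow_ne_top_of_nonneg (by linarith) (by simp)) (by simp)

lemma KK_ne_zero (p : ℝ) : KK p ≠ 0 := by
  unfold KK
  refine mul_ne_zero ?_ (by simp)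
  exact (ENNReal.rpow_pos (by norm_num) (by simp)).ne'

lemma upper_half {p : ℝ} (hp0 : 0 < p) (hp1 : p < 1) {f : ℂ → ℂ} (hf : ExpTypePi f)
    (hI : (∫⁻ x : ℝ, (‖f x‖₊ : ℝ≥0∞) ^ p) < ⊤) :
    ∫⁻ y in Set.Ioi (0:ℝ), ∫⁻ x : ℝ, ENNReal.ofReal
            (Real.exp (-Real.pi * |y|) * |y| ^ (1 / p - 2)) * (‖f (x + y * I)‖₊ : ℝ≥0∞) ≤
      KK p * (∫⁻ x : ℝ, (‖f x‖₊ : ℝ≥0∞) ^ p) ^ (1 / p) := by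
  set J := ∫⁻ x : ℝ, (‖f x‖₊ : ℝ≥0∞) ^ p with hJ
  have hc : Continuous (fun A : ℝ => KK p * ENNReal.ofReal A ^ (1 / p)) := by
    refine (ENNReal.continuous_const_mul (KK_ne_top hp0 hp1)).comp ?_
    exact ENNReal.continuous_rpow_const.comp ENNReal.continuous_ofReal
  have ht := (hc.tendsto J.toReal).mono_left (nhdsWithin_le_nhds (s := Set.Ioi J.toReal))
  simp only [ENNReal.ofReal_toReal hI.ne] at ht
  refine ge_of_tendsto ht ?_
  filter_upwards [self_mem_nhdsWithin] with A hA
  have hA : J.toReal < A := hA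
  refine upper_A hp0 hp1 hf hI (lt_of_le_of_lt ENNReal.toReal_nonneg hA) ?_
  rw [← hJ, ← ENNReal.ofReal_toReal hI.ne]
  exact ENNReal.ofReal_le_ofReal hA.le

lemma lintegral_complex {g : ℂ → ℝ≥0∞} (hg : Measurable g) :
    ∫⁻ z : ℂ, g z = ∫⁻ y : ℝ, ∫⁻ x : ℝ, g (x + y * I) := by
  rw [← (Complex.volume_preserving_equiv_real_prod.symm).lintegral_comp_emb
    measurableEquivRealProd.symm.measurableEmbedding, Measure.volume_eq_prod,
    lintegral_prod_symm]
  · congr 1; ext y; congr 1; ext x; congr 1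
    apply Complex.ext <;> simp
  · exact (hg.comp measurableEquivRealProd.symm.measurable).aemeasurable

/-- For `0 < p < 1`, `Eᵖ` embeds continuously into the weighted Bergman-type space
of entire functions with norm `∫_ℂ e^{-π|Im z|} |Im z|^{1/p-2} |f(z)| dA(z)`. -/
theorem Ep_embeds_into_envelope_space (p : ℝ) (hp0 : 0 < p) (hp1 : p < 1) :
    ∃ C : ℝ, 0 < C ∧ ∀ f : ℂ → ℂ, ExpTypePi f →
      (∫⁻ x : ℝ, (‖f x‖₊ : ℝ≥0∞) ^ p) < ⊤ →
      (∫⁻ z : ℂ, ENNReal.ofReal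
            (Real.exp (-Real.pi * |z.im|) * |z.im| ^ (1 / p - 2)) * (‖f z‖₊ : ℝ≥0∞)) ≤
        ENNReal.ofReal C * (∫⁻ x : ℝ, (‖f x‖₊ : ℝ≥0∞) ^ p) ^ (1 / p) := by
  have hKt := KK_ne_top hp0 hp1
  have h2K : 2 * KK p ≠ ⊤ := ENNReal.mul_ne_top (by simp) hKt
  refine ⟨(2 * KK p).toReal, ENNReal.toReal_pos (mul_ne_zero (by simp) (KK_ne_zero p)) h2K,
    fun f hf hI => ?_⟩
  rw [ENNReal.ofReal_toReal h2K]
  have hfm : Measurable f := hf.1.continuous.measurable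
  rw [lintegral_complex (by fun_prop)]
  have e : ∀ x y : ℝ, ((x:ℂ) + y * I).im = y := by intro x y; simp
  simp only [e]
  set F : ℝ → ℝ≥0∞ := fun y => ∫⁻ x : ℝ, ENNReal.ofReal
            (Real.exp (-Real.pi * |y|) * |y| ^ (1 / p - 2)) * (‖f (x + y * I)‖₊ : ℝ≥0∞) with hF
  have hup : ∫⁻ y in Set.Ioi (0:ℝ), F y ≤ _ := upper_half hp0 hp1 hf hI
  have hlow : ∫⁻ y in Set.Iic (0:ℝ), F y ≤
      KK p * (∫⁻ x : ℝ, (‖f x‖₊ : ℝ≥0∞) ^ p) ^ (1 / p) := by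
    have h1 := upper_half hp0 hp1 hf.comp_neg (by rw [lp_neg]; exact hI)
    rw [lp_neg] at h1
    refine le_trans (le_of_eq ?_) h1
    have h2 : ∀ y : ℝ, (∫⁻ x : ℝ, ENNReal.ofReal
            (Real.exp (-Real.pi * |y|) * |y| ^ (1 / p - 2)) *
              (‖f (-(x + y * I))‖₊ : ℝ≥0∞)) = F (-y) := by
      intro y
      simp only [hF]
      rw [← lintegral_neg_eq_self (μ := volume)]
      congr 1; ext x
      rw [abs_neg]
      congr 4
      push_cast; ring
    simp only [h2]
    rw [← setLIntegral_congr (Iio_ae_eq_Iic (a := (0:ℝ)) (μ := volume)),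
      ← lintegral_indicator measurableSet_Iio, ← lintegral_indicator measurableSet_Ioi,
      ← lintegral_neg_eq_self (μ := volume)]
    congr 1; ext y
    simp [Set.indicator]
  rw [← lintegral_add_compl F (measurableSet_Ioi (a := (0:ℝ))), Set.compl_Ioi]
  calc _ ≤ _ := add_le_add hup hlow
    _ = _ := by ring
end
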